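/- arXiv:2004.09553 — 14 statements merged into one kernel-verified Lean document; each statement's English description precedes it below -/
import Mathlib

section
/- In any idempotent residuated lattice A, for all x, y ∈ A: if 1 ≤ x·y then x·y = x ∨ y, and if x·y ≤ 1 then x·y = x ∧ y. In particular, if 1 ≤ x and 1 ≤ y then x·y = x ∨ y, and if x ≤ 1 and y ≤ 1 then x·y = x ∧ y. -/
/-- In any idempotent residuated lattice: if `1 ≤ x*y` then `x*y = x ⊔ y`; if `x*y ≤ 1`
then `x*y = x ⊓ y`; in particular if `1 ≤ x` and `1 ≤ y` then `x*y = x ⊔ y`, and if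
`x ≤ 1` and `y ≤ 1` then `x*y = x ⊓ y`. -/
theorem stmt_1 {α : Type*} [Lattice α] [Monoid α]
    (ldiv rdiv : α → α → α)
    (hld : ∀ a b c : α, b ≤ ldiv a c ↔ a * b ≤ c)
    (hrd : ∀ a b c : α, a * b ≤ c ↔ a ≤ rdiv c b)
    (idem : ∀ a : α, a * a = a) :
    ∀ x y : α,
      (1 ≤ x * y → x * y = x ⊔ y) ∧
      (x * y ≤ 1 → x * y = x ⊓ y) ∧
      (1 ≤ x → 1 ≤ y → x * y = x ⊔ y) ∧
      (x ≤ 1 → y ≤ 1 → x * y = x ⊓ y) := by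
  have mono : ∀ {a b c d : α}, a ≤ b → c ≤ d → a * c ≤ b * d := fun {a b c d} hab hcd =>
    calc a * c ≤ a * d := (hld _ _ _).1 (hcd.trans ((hld _ _ _).2 le_rfl))
      _ ≤ b * d := (hrd _ _ _).2 (hab.trans ((hrd _ _ _).1 le_rfl))
  intro x y
  have left_absorb : x * (x * y) = x * y := by rw [← mul_assoc, idem]
  have right_absorb : x * y * y = x * y := by rw [mul_assoc, idem]
  have eq_sup : 1 ≤ x * y → x * y = x ⊔ y := fun h => by
    refine le_antisymm ?_ (sup_le ?_ ?_)
    · simpa only [idem] using mono (le_sup_left : x ≤ x ⊔ y) (le_sup_right : y ≤ x ⊔ y)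
    · simpa only [left_absorb, mul_one] using mono (le_refl x) h
    · simpa only [right_absorb, one_mul] using mono h (le_refl y)
  have eq_inf : x * y ≤ 1 → x * y = x ⊓ y := fun h => by
    refine le_antisymm (le_inf ?_ ?_) ?_
    · simpa only [left_absorb, mul_one] using mono (le_refl x) h
    · simpa only [right_absorb, one_mul] using mono h (le_refl y)
    · simpa only [idem] using mono (inf_le_left : x ⊓ y ≤ x) (inf_le_right : x ⊓ y ≤ y)
  exact ⟨eq_sup, eq_inf,
    fun hx hy => eq_sup (by simpa only [mul_one] using mono hx hy),
    fun hx hy => eq_inf (by simpa only [mul_one] using mono hx hy)⟩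
end

section
/- In any idempotent residuated lattice A, for all x, y, z ∈ A with x ≤ 1, y ≤ 1, and z ≤ 1: x ∧ z ≤ y if and only if z ≤ (x\y) ∧ 1. (Thus the negative cone ↓1, with x ⇒ y := (x\y) ∧ 1, is a Brouwerian algebra.) -/
/-- In any idempotent residuated lattice, for all `x, y, z ≤ 1`:
`x ⊓ z ≤ y ↔ z ≤ (x \ y) ⊓ 1`.  (Thus the negative cone, with `x ⇒ y := (x \ y) ⊓ 1`,
is a Brouwerian algebra.) -/
theorem stmt_2 {α : Type*} [Lattice α] [Monoid α]
    (ldiv rdiv : α → α → α)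
    (hld : ∀ a b c : α, b ≤ ldiv a c ↔ a * b ≤ c)
    (hrd : ∀ a b c : α, a * b ≤ c ↔ a ≤ rdiv c b)
    (idem : ∀ a : α, a * a = a) :
    ∀ x y z : α, x ≤ 1 → y ≤ 1 → z ≤ 1 →
      (x ⊓ z ≤ y ↔ z ≤ ldiv x y ⊓ 1) := by
  intro x y z hx _ hz
  have mul_mono_left : ∀ {a b : α} (c : α), a ≤ b → c * a ≤ c * b := fun c h =>
    (hld _ _ _).1 (h.trans ((hld _ _ _).2 le_rfl))
  have mul_mono_right : ∀ {a b : α} (c : α), a ≤ b → a * c ≤ b * c := fun c h =>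
    (hrd _ _ _).2 (h.trans ((hrd _ _ _).1 le_rfl))
  have mul_eq_inf : x * z = x ⊓ z := by
    apply le_antisymm
    · exact le_inf (by simpa using mul_mono_left x hz) (by simpa using mul_mono_right z hx)
    · calc x ⊓ z = (x ⊓ z) * (x ⊓ z) := (idem _).symm
        _ ≤ x * (x ⊓ z) := mul_mono_right _ inf_le_left
        _ ≤ x * z := mul_mono_left _ inf_le_right
  rw [le_inf_iff, hld, mul_eq_inf, and_iff_left hz]
end

section
/- For any idempotent residuated lattice A, the relation ⊑ defined by x ⊑ y ⟺ x·y = x is a preorder on A (reflexive and transitive) whose greatest element is 1 (i.e., x ⊑ 1 for all x); if A has a least element ⊥ with respect to ≤, then ⊥ ⊑ x for all x ∈ A. Moreover, for all x, y ∈ A: (i) if 1 ≤ x and 1 ≤ y, then x ≤ y ⟺ y ⊑ x; (ii) if x ≤ 1 and y ≤ 1, then x ≤ y ⟺ x ⊑ y. -/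
/-- For an idempotent residuated lattice, the relation `x ⊑ y ⟺ x * y = x` is a preorder
with greatest element `1`; any `≤`-least element is also `⊑`-least; and the compatibility
conditions (i), (ii) on the positive and negative cones hold. -/
theorem stmt_3 {α : Type*} [Lattice α] [Monoid α]
    (ldiv rdiv : α → α → α)
    (hld : ∀ a b c : α, b ≤ ldiv a c ↔ a * b ≤ c)
    (hrd : ∀ a b c : α, a * b ≤ c ↔ a ≤ rdiv c b)
    (idem : ∀ a : α, a * a = a) :
    -- reflexivity of ⊑
    (∀ x : α, x * x = x) ∧
    -- transitivity of ⊑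
    (∀ x y z : α, x * y = x → y * z = y → x * z = x) ∧
    -- 1 is the ⊑-greatest element
    (∀ x : α, x * 1 = x) ∧
    -- a ≤-least element is the ⊑-least element
    (∀ bot : α, (∀ a : α, bot ≤ a) → ∀ x : α, bot * x = bot) ∧
    -- (i) on the positive cone
    (∀ x y : α, 1 ≤ x → 1 ≤ y → (x ≤ y ↔ y * x = y)) ∧
    -- (ii) on the negative cone
    (∀ x y : α, x ≤ 1 → y ≤ 1 → (x ≤ y ↔ x * y = x)) := by
  have mul_mono_left : ∀ a b c : α, b ≤ c → a * b ≤ a * c := fun a b c h =>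
    (hld a b _).1 (h.trans ((hld a c _).2 le_rfl))
  have mul_mono_right : ∀ a b c : α, b ≤ c → b * a ≤ c * a := fun a b c h =>
    (hrd b a _).2 (h.trans ((hrd c a _).1 le_rfl))
  refine ⟨idem, fun x y z hxy hyz => ?_, mul_one, fun bot hbot x => ?_,
    fun x y hx hy => ⟨fun h => ?_, fun h => ?_⟩, fun x y hx hy => ⟨fun h => ?_, fun h => ?_⟩⟩
  · calc x * z = x * y * z := by rw [hxy]
      _ = x := by rw [mul_assoc, hyz, hxy]
  · exact le_antisymm ((hrd _ _ _).2 (hbot _)) (hbot _)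
  · apply le_antisymm
    · simpa only [idem] using mul_mono_left y x y h
    · simpa only [mul_one] using mul_mono_left y 1 x hx
  · simpa only [one_mul, h] using mul_mono_right x 1 y hy
  · apply le_antisymm
    · simpa only [mul_one] using mul_mono_left x y 1 hy
    · simpa only [idem] using mul_mono_left x x y h
  · simpa only [one_mul, h] using mul_mono_right y x 1 hx
end

section
/- In any commutative idempotent residuated lattice A, the monoidal preorder ⊑ (defined by x ⊑ y ⟺ x·y = x) is a partial order (in particular antisymmetric), for all x, y ∈ A the product x·y is the greatest lower bound of {x, y} with respect to ⊑, and 1 is the ⊑-greatest element. Moreover, if the lattice order of A is total, then ⊑ is a total order. -/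
/-- Multiplication by a fixed element is monotone when it has a residual. -/
theorem mul_le_mul_left_of_resid {α : Type*} [Lattice α] [CommMonoid α]
    {arrow : α → α → α} (resid : ∀ a b c : α, a * b ≤ c ↔ b ≤ arrow a c)
    (a : α) {b c : α} (h : b ≤ c) : a * b ≤ a * c :=
  (resid a b (a * c)).2 (h.trans ((resid a c (a * c)).1 le_rfl))

/-- If `x ≤ y` and `x * y` is comparable with `1`, then `x * y` is one of its factors. -/
theorem mul_eq_left_or_right_of_le {α : Type*} [Lattice α] [CommMonoid α]
    {arrow : α → α → α} (resid : ∀ a b c : α, a * b ≤ c ↔ b ≤ arrow a c)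
    (idem : ∀ a : α, a * a = a) {x y : α} (hxy : x ≤ y)
    (h1 : x * y ≤ 1 ∨ 1 ≤ x * y) : x * y = x ∨ x * y = y := by
  rcases h1 with h | h
  · left
    apply le_antisymm
    · simpa [← mul_assoc, idem] using mul_le_mul_left_of_resid resid x h
    · simpa [idem] using mul_le_mul_left_of_resid resid x hxy
  · right
    apply le_antisymm
    · simpa [idem, mul_comm] using mul_le_mul_left_of_resid resid y hxy
    · simpa [mul_left_comm y x y, idem] using mul_le_mul_left_of_resid resid y h

/-- In a commutative idempotent residuated lattice, the monoidal preorder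
`x ⊑ y ⟺ x * y = x` is a partial order, `x * y` is the ⊑-greatest lower bound of
`{x, y}`, `1` is the ⊑-greatest element, and if the lattice order is total then ⊑ is
total. -/
theorem stmt_4 {α : Type*} [Lattice α] [CommMonoid α]
    (arrow : α → α → α)
    (resid : ∀ a b c : α, a * b ≤ c ↔ b ≤ arrow a c)
    (idem : ∀ a : α, a * a = a) :
    -- antisymmetry (with reflexivity given by idempotence and transitivity by associativity)
    (∀ x y : α, x * y = x → y * x = y → x = y) ∧
    -- x * y is a ⊑-lower bound of x and y
    (∀ x y : α, (x * y) * x = x * y ∧ (x * y) * y = x * y) ∧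
    -- x * y is the greatest ⊑-lower bound of x and y
    (∀ x y z : α, z * x = z → z * y = z → z * (x * y) = z) ∧
    -- 1 is the ⊑-greatest element
    (∀ x : α, x * 1 = x) ∧
    -- if the lattice order is total then ⊑ is total
    ((∀ a b : α, a ≤ b ∨ b ≤ a) → ∀ x y : α, x * y = x ∨ x * y = y) := by
  refine ⟨fun x y hx hy => ?_, fun x y => ⟨?_, ?_⟩, fun x y z hx hy => ?_, mul_one,
    fun total x y => ?_⟩
  · rw [← hx, mul_comm, hy]
  · rw [mul_right_comm, idem]
  · rw [mul_assoc, idem]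
  · rw [← mul_assoc, hx, hy]
  · rcases total x y with h | h
    · exact mul_eq_left_or_right_of_le resid idem h (total _ _)
    · rw [mul_comm]
      exact (mul_eq_left_or_right_of_le resid idem h (total _ _)).symm
end

section
/- Every idempotent residuated chain A is conservative: for all x, y ∈ A, either x·y = x or x·y = y. -/
/-- In a totally ordered idempotent monoid, `x * y` is the maximum of `x` and `y` if `1 ≤ x * y`,
and their minimum if `x * y ≤ 1`. -/
theorem mul_eq_left_or_right_of_idempotent {α : Type*} [LinearOrder α] [Monoid α]
    (mul_mono : ∀ {a b c d : α}, a ≤ b → c ≤ d → a * c ≤ b * d)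
    (idem : ∀ a : α, a * a = a) (x y : α) : x * y = x ∨ x * y = y := by
  have hx : x * (x * y) = x * y := by rw [← mul_assoc, idem]
  have hy : x * y * y = x * y := by rw [mul_assoc, idem]
  rcases le_total 1 (x * y) with h | h
  · have hxp : x ≤ x * y := by simpa [hx] using mul_mono (le_refl x) h
    have hyp : y ≤ x * y := by simpa [hy] using mul_mono h (le_refl y)
    rcases le_total x y with hxy | hxy
    · exact Or.inr (le_antisymm (by simpa [idem] using mul_mono hxy (le_refl y)) hyp)
    · exact Or.inl (le_antisymm (by simpa [idem] using mul_mono (le_refl x) hxy) hxp)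
  · have hxp : x * y ≤ x := by simpa [hx] using mul_mono (le_refl x) h
    have hyp : x * y ≤ y := by simpa [hy] using mul_mono h (le_refl y)
    rcases le_total x y with hxy | hxy
    · exact Or.inl (le_antisymm hxp (by simpa [idem] using mul_mono (le_refl x) hxy))
    · exact Or.inr (le_antisymm hyp (by simpa [idem] using mul_mono hxy (le_refl y)))

/-- Every idempotent residuated chain is conservative: `x * y = x` or `x * y = y`. -/
theorem stmt_5 {α : Type*} [LinearOrder α] [Monoid α]
    (ldiv rdiv : α → α → α)
    (hld : ∀ a b c : α, b ≤ ldiv a c ↔ a * b ≤ c)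
    (hrd : ∀ a b c : α, a * b ≤ c ↔ a ≤ rdiv c b)
    (idem : ∀ a : α, a * a = a) :
    ∀ x y : α, x * y = x ∨ x * y = y := by
  refine mul_eq_left_or_right_of_idempotent (fun {a b c d} hab hcd => ?_) idem
  calc a * c ≤ b * c := (hrd _ _ _).2 (hab.trans ((hrd _ _ _).1 le_rfl))
    _ ≤ b * d := (hld _ _ _).1 (hcd.trans ((hld _ _ _).2 le_rfl))
end

section
/- If A is a conservative residuated lattice, then its cone ↓1 ∪ ↑1 is a chain: any two elements x, y ∈ A each satisfying x ≤ 1 or 1 ≤ x (and y ≤ 1 or 1 ≤ y) are comparable with respect to ≤. -/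
/-- If `A` is a conservative residuated lattice, then its cone `↓1 ∪ ↑1` is a chain. -/
theorem stmt_6 {α : Type*} [Lattice α] [Monoid α]
    (ldiv rdiv : α → α → α)
    (hld : ∀ a b c : α, b ≤ ldiv a c ↔ a * b ≤ c)
    (hrd : ∀ a b c : α, a * b ≤ c ↔ a ≤ rdiv c b)
    (cons : ∀ a b : α, a * b = a ∨ a * b = b) :
    ∀ x y : α, (x ≤ 1 ∨ 1 ≤ x) → (y ≤ 1 ∨ 1 ≤ y) → (x ≤ y ∨ y ≤ x) := by
  have mul_mono_right : ∀ a b c : α, b ≤ c → a * b ≤ a * c := fun a b c h =>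
    (hld a b _).1 (h.trans ((hld a c _).2 le_rfl))
  have mul_mono_left : ∀ a b c : α, b ≤ c → b * a ≤ c * a := fun a b c h =>
    (hrd b a _).2 (h.trans ((hrd c a _).1 le_rfl))
  rintro x y (hx | hx) (hy | hy)
  · have h₁ : x * y ≤ x := by simpa using mul_mono_right x y 1 hy
    have h₂ : x * y ≤ y := by simpa using mul_mono_left y x 1 hx
    rcases cons x y with h | h
    · exact Or.inl (h.ge.trans h₂)
    · exact Or.inr (h.ge.trans h₁)
  · exact Or.inl (hx.trans hy)
  · exact Or.inr (hy.trans hx)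
  · have h₁ : x ≤ x * y := by simpa using mul_mono_right x 1 y hy
    have h₂ : y ≤ x * y := by simpa using mul_mono_left y 1 x hx
    rcases cons x y with h | h
    · exact Or.inr (h₂.trans h.le)
    · exact Or.inl (h₁.trans h.le)
end

section
/- Let (C, ≤) be a chain and ⊑ a total order on C compatible with it (with ⊑-greatest element 1). Define x·y = x if x ⊑ y, and x·y = y otherwise. Then · is associative, commutative, and idempotent, 1 is an identity for ·, and x·(y ∨ z) = (x·y) ∨ (x·z) for all x, y, z ∈ C (where ∨ is the join of ≤). Moreover, if C is finite, then · is residuated: for all x, y ∈ C, the set {z ∈ C : x·z ≤ y} has a greatest element. -/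
/-- Given a chain `(C, ≤)` and a compatible total order `⊑` (with ⊑-greatest element `e`),
the operation `x · y = x` if `x ⊑ y` and `y` otherwise is an associative, commutative,
idempotent operation with identity `e` that distributes over joins; moreover if `C` is
finite then it is residuated. -/
theorem stmt_8 {C : Type*} [LinearOrder C]
    (r : C → C → Prop) (e : C)
    (hrefl : ∀ x, r x x)
    (hantisymm : ∀ x y, r x y → r y x → x = y)
    (htrans : ∀ x y z, r x y → r y z → r x z)
    (htotal : ∀ x y, r x y ∨ r y x)
    (hgreatest : ∀ x, r x e)
    (hbot : ∀ bot : C, (∀ a, bot ≤ a) → ∀ x, r bot x)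
    (hpos : ∀ x y, e ≤ x → e ≤ y → (x ≤ y ↔ r y x))
    (hneg : ∀ x y, x ≤ e → y ≤ e → (x ≤ y ↔ r x y))
    (m : C → C → C)
    (hm : ∀ x y, (r x y → m x y = x) ∧ (¬ r x y → m x y = y)) :
    (∀ x y z, m (m x y) z = m x (m y z)) ∧
    (∀ x y, m x y = m y x) ∧
    (∀ x, m x x = x) ∧
    (∀ x, m x e = x ∧ m e x = x) ∧
    (∀ x y z, m x (y ⊔ z) = m x y ⊔ m x z) ∧
    (Finite C → ∀ x y, ∃ z, m x z ≤ y ∧ ∀ w, m x w ≤ y → w ≤ z) := by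
  have left : ∀ {x y}, r x y → m x y = x := fun {x y} h => (hm x y).1 h
  have right : ∀ {x y}, r y x → m x y = y := fun {x y} h => by
    by_cases h' : r x y
    · rw [left h', hantisymm x y h' h]
    · exact (hm x y).2 h'
  have mono : ∀ x y z, y ≤ z → m x y ≤ m x z := by
    intro x y z hyz
    by_cases hxy : r x y <;> by_cases hxz : r x z
    · rw [left hxy, left hxz]
    · have hzx : r z x := (htotal x z).resolve_left hxz
      rw [left hxy, right hzx]
      have hez : e ≤ z := by
        by_contra! h
        exact hxz (htrans x y z hxy ((hneg y z (hyz.trans h.le) h.le).1 hyz))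
      rcases le_total x e with hx | hx
      · exact hx.trans hez
      · exact (hpos x z hx hez).2 hzx
    · have hyx : r y x := (htotal x y).resolve_left hxy
      rw [right hyx, left hxz]
      have hye : y ≤ e := by
        by_contra! h
        exact hxy (htrans x z y hxz ((hpos y z h.le (h.le.trans hyz)).1 hyz))
      rcases le_total x e with hx | hx
      · exact (hneg y x hye hx).2 hyx
      · exact hye.trans hx
    · rwa [(hm x y).2 hxy, (hm x z).2 hxz]
  refine ⟨fun x y z => ?_, fun x y => ?_, fun x => left (hrefl x),
    fun x => ⟨left (hgreatest x), right (hgreatest x)⟩,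
    fun x y z => Monotone.map_sup (fun _ _ h => mono x _ _ h) y z, fun _ x y => ?_⟩
  · rcases htotal x y with hxy | hyx <;> rcases htotal y z with hyz | hzy
    · rw [left hxy, left hyz, left hxy, left (htrans x y z hxy hyz)]
    · rw [left hxy, right hzy]
    · rw [right hyx, left hyz, right hyx]
    · rw [right hyx, right hzy, right (htrans z y x hzy hyx)]
  · rcases htotal x y with h | h
    · rw [left h, right h]
    · rw [right h, left h]
  · have : Nonempty C := ⟨e⟩
    obtain ⟨bot, hb⟩ := Finite.exists_min (id : C → C)
    have hne : {z | m x z ≤ y}.Nonempty := ⟨bot, by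
      rw [Set.mem_ofPred_eq, right (hbot bot hb x)]
      exact hb y⟩
    obtain ⟨z, hz, hmax⟩ := Set.exists_max_image _ id (Set.toFinite {z | m x z ≤ y}) hne
    exact ⟨z, hz, hmax⟩
end

section
/- Let (C, ≤) be a finite chain with n ≥ 2 elements. Then the number of total orders ⊑ on C that are compatible with (C, ≤) is exactly 2^(n−2). -/
/-- `r` is a total order on the chain `C`, compatible with the chain order `≤`. -/
def IsCompatTotalOrder {C : Type*} [LinearOrder C] (r : C → C → Prop) : Prop :=
  (∀ x, r x x) ∧ (∀ x y, r x y → r y x → x = y) ∧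
  (∀ x y z, r x y → r y z → r x z) ∧ (∀ x y, r x y ∨ r y x) ∧
  ∃ e : C, (∀ x, r x e) ∧
    (∀ bot : C, (∀ a, bot ≤ a) → ∀ x, r bot x) ∧
    (∀ x y, e ≤ x → e ≤ y → (x ≤ y ↔ r y x)) ∧
    (∀ x y, x ≤ e → y ≤ e → (x ≤ y ↔ r x y))

/-- `r` is a total order on the chain `C` that is unimodal: no element lies strictly `r`-below
both an element on its left and an element on its right. -/
def IsUnimodalOrder {C : Type*} [LinearOrder C] (r : C → C → Prop) : Prop :=
  (∀ x, r x x) ∧ (∀ x y, r x y → r y x → x = y) ∧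
  (∀ x y z, r x y → r y z → r x z) ∧ (∀ x y, r x y ∨ r y x) ∧
  ∀ x y z, x < y → y < z → r x y ∨ r z y

theorem exists_greatest_of_trans_total {C : Type*} [Finite C] [Nonempty C] (r : C → C → Prop)
    (htrans : ∀ x y z, r x y → r y z → r x z) (htotal : ∀ x y, r x y ∨ r y x) :
    ∃ e, ∀ x, r x e := by
  have : IsTrans C r := ⟨htrans⟩
  have hrefl : ∀ x, r x x := fun x => (htotal x x).elim id id
  have hd : Directed r (id : C → C) := fun x y =>
    (htotal x y).elim (fun h => ⟨y, h, hrefl y⟩) (fun h => ⟨x, hrefl x, h⟩)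
  exact hd.finite_le id

theorem isCompatTotalOrder_iff {C : Type*} [Finite C] [Nonempty C] [LinearOrder C]
    (r : C → C → Prop) :
    IsCompatTotalOrder r ↔ IsUnimodalOrder r ∧ ∀ bot : C, (∀ a, bot ≤ a) → ∀ x, r bot x := by
  constructor
  · rintro ⟨hrefl, hanti, htrans, htotal, e, -, hbot, hright, hleft⟩
    refine ⟨⟨hrefl, hanti, htrans, htotal, fun x y z hxy hyz => ?_⟩, hbot⟩
    rcases le_total y e with h | h
    · exact Or.inl ((hleft x y (hxy.le.trans h) h).1 hxy.le)
    · exact Or.inr ((hright y z h (h.trans hyz.le)).1 hyz.le)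
  · rintro ⟨⟨hrefl, hanti, htrans, htotal, huni⟩, hbot⟩
    obtain ⟨e, he⟩ := exists_greatest_of_trans_total r htrans htotal
    have hleft : ∀ x y, x ≤ y → y ≤ e → r x y := by
      intro x y hxy hye
      rcases hxy.eq_or_lt with rfl | hxy
      · exact hrefl x
      rcases hye.eq_or_lt with rfl | hye
      · exact he x
      exact (huni x y e hxy hye).resolve_right fun h => hye.ne (hanti _ _ (he y) h)
    have hright : ∀ x y, e ≤ x → x ≤ y → r y x := by
      intro x y hex hxy
      rcases hxy.eq_or_lt with rfl | hxy
      · exact hrefl x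
      rcases hex.eq_or_lt with rfl | hex
      · exact he y
      exact (huni e x y hex hxy).resolve_left fun h => hex.ne (hanti _ _ h (he x))
    refine ⟨hrefl, hanti, htrans, htotal, e, he, hbot, fun x y hx hy => ⟨hright x y hx, ?_⟩,
      fun x y hx hy => ⟨fun h => hleft x y h hy, ?_⟩⟩
    · intro h
      rcases le_total x y with hxy | hxy
      · exact hxy
      · exact (hanti _ _ (hright y x hy hxy) h).le
    · intro h
      rcases le_total x y with hxy | hxy
      · exact hxy
      · exact (hanti _ _ h (hleft y x hxy hx)).le

/-- Unimodal orders whose least element is a given endpoint `a` of the chain correspond, by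
restriction, to unimodal orders on the chain without `a`. -/
def unimodalOrderEquivOfLeast {C : Type*} [LinearOrder C] (a : C) (ha : IsBot a ∨ IsTop a) :
    {r : C → C → Prop // IsUnimodalOrder r ∧ ∀ x, r a x} ≃
      {r : {x : C // x ≠ a} → {x : C // x ≠ a} → Prop // IsUnimodalOrder r} where
  toFun r := ⟨fun x y => r.1 x y, by
    obtain ⟨r, ⟨hrefl, hanti, htrans, htotal, huni⟩, -⟩ := r
    exact ⟨fun x => hrefl x, fun x y h h' => Subtype.ext (hanti _ _ h h'),
      fun x y z => htrans _ _ _, fun x y => htotal _ _, fun x y z => huni _ _ _⟩⟩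
  invFun r := ⟨fun x y => x = a ∨ ∃ (hx : x ≠ a) (hy : y ≠ a), r.1 ⟨x, hx⟩ ⟨y, hy⟩, by
    obtain ⟨r, hrefl, hanti, htrans, htotal, huni⟩ := r
    refine ⟨⟨fun x => ?_, ?_, ?_, fun x y => ?_, ?_⟩, fun x => Or.inl rfl⟩
    · by_cases hx : x = a
      · exact Or.inl hx
      · exact Or.inr ⟨hx, hx, hrefl _⟩
    · rintro x y (rfl | ⟨hx, hy, h⟩) (h' | ⟨hy', hx', h'⟩)
      · exact h'.symm
      · exact absurd rfl hx'
      · exact absurd h' hy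
      · exact congrArg Subtype.val (hanti _ _ h h')
    · rintro x y z (rfl | ⟨hx, hy, h⟩) (h' | ⟨hy', hz, h'⟩)
      · exact Or.inl rfl
      · exact Or.inl rfl
      · exact absurd h' hy
      · exact Or.inr ⟨hx, hz, htrans _ _ _ h h'⟩
    · by_cases hx : x = a
      · exact Or.inl (Or.inl hx)
      by_cases hy : y = a
      · exact Or.inr (Or.inl hy)
      exact (htotal ⟨x, hx⟩ ⟨y, hy⟩).imp (fun h => Or.inr ⟨hx, hy, h⟩)
        (fun h => Or.inr ⟨hy, hx, h⟩)
    · intro x y z hxy hyz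
      by_cases hx : x = a
      · exact Or.inl (Or.inl hx)
      by_cases hz : z = a
      · exact Or.inr (Or.inl hz)
      have hy : y ≠ a := by
        rintro rfl
        exact ha.elim (fun h => (h x).not_gt hxy) (fun h => (h z).not_gt hyz)
      exact (huni ⟨x, hx⟩ ⟨y, hy⟩ ⟨z, hz⟩ hxy hyz).imp (fun h => Or.inr ⟨hx, hy, h⟩)
        (fun h => Or.inr ⟨hz, hy, h⟩)⟩
  left_inv := by
    rintro ⟨r, ⟨hrefl, hanti, htrans, htotal, huni⟩, hr⟩
    refine Subtype.ext (funext fun x => funext fun y => propext ⟨?_, fun h => ?_⟩)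
    · rintro (rfl | ⟨_, _, h⟩)
      · exact hr y
      · exact h
    · by_cases hx : x = a
      · exact Or.inl hx
      · refine Or.inr ⟨hx, ?_, h⟩
        rintro rfl
        exact hx (hanti _ _ h (hr x))
  right_inv := by
    rintro ⟨r, hr⟩
    refine Subtype.ext (funext fun x => funext fun y => propext ⟨?_, fun h => ?_⟩)
    · rintro (h | ⟨_, _, h⟩)
      · exact absurd h x.2
      · exact h
    · exact Or.inr ⟨x.2, y.2, h⟩

theorem IsUnimodalOrder.least_isBot_or_isTop {C : Type*} [LinearOrder C] {r : C → C → Prop}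
    (h : IsUnimodalOrder r) {m : C} (hm : ∀ x, r m x) : IsBot m ∨ IsTop m := by
  obtain ⟨-, hanti, -, -, huni⟩ := h
  by_contra! hc
  simp only [IsBot, IsTop, not_forall, not_le] at hc
  obtain ⟨⟨x, hx⟩, ⟨z, hz⟩⟩ := hc
  rcases huni x m z hx hz with h | h
  · exact hx.ne (hanti _ _ h (hm x))
  · exact hz.ne (hanti _ _ (hm z) h)

theorem card_isUnimodalOrder (m : ℕ) {C : Type*} [Finite C] [LinearOrder C]
    (hC : Nat.card C = m + 1) :
    Nat.card {r : C → C → Prop // IsUnimodalOrder r} = 2 ^ m := by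
  classical
  induction m generalizing C with
  | zero =>
    obtain ⟨hsub, ⟨c⟩⟩ := Nat.card_eq_one_iff_unique.1 hC
    rw [pow_zero, Nat.card_eq_one_iff_unique]
    refine ⟨⟨?_⟩, ⟨⟨fun _ _ => True, ?_⟩⟩⟩
    · rintro ⟨r, hr, -⟩ ⟨s, hs, -⟩
      refine Subtype.ext (funext fun x => funext fun y => ?_)
      obtain rfl := Subsingleton.elim x y
      exact propext ⟨fun _ => hs x, fun _ => hr x⟩
    · exact ⟨fun _ => trivial, fun x y _ _ => Subsingleton.elim x y, fun _ _ _ _ _ => trivial,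
        fun _ _ => Or.inl trivial, fun _ _ _ _ _ => Or.inl trivial⟩
  | succ m ih =>
    have : Nontrivial C := Finite.one_lt_card_iff_nontrivial.1 (by omega)
    obtain ⟨b, hb⟩ : ∃ b : C, IsBot b :=
      exists_greatest_of_trans_total (fun x y : C => y ≤ x) (fun _ _ _ h h' => h'.trans h)
        (fun x y => le_total y x)
    obtain ⟨t, ht⟩ : ∃ t : C, IsTop t :=
      exists_greatest_of_trans_total (fun x y : C => x ≤ y) (fun _ _ _ => le_trans) le_total
    have hbt : b ≠ t := by
      rintro rfl
      obtain ⟨x, hx⟩ := exists_ne b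
      exact hx (le_antisymm (ht x) (hb x))
    have hcard : ∀ a : C, IsBot a ∨ IsTop a →
        Nat.card {r : C → C → Prop // IsUnimodalOrder r ∧ ∀ x, r a x} = 2 ^ m := by
      intro a ha
      rw [Nat.card_congr (unimodalOrderEquivOfLeast a ha)]
      apply ih
      have := Fintype.ofFinite C
      rw [Nat.card_eq_fintype_card] at hC ⊢
      simp [Fintype.card_subtype_compl, hC]
    have hiff : ∀ r : C → C → Prop, IsUnimodalOrder r ↔
        (IsUnimodalOrder r ∧ ∀ x, r b x) ∨ (IsUnimodalOrder r ∧ ∀ x, r t x) := by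
      refine fun r => ⟨fun h => ?_, fun h => h.elim And.left And.left⟩
      obtain ⟨l, hl⟩ := exists_greatest_of_trans_total (fun x y => r y x)
        (fun x y z hxy hyz => h.2.2.1 _ _ _ hyz hxy) (fun x y => h.2.2.2.1 y x)
      rcases h.least_isBot_or_isTop hl with h' | h'
      · obtain rfl := le_antisymm (h' b) (hb l)
        exact Or.inl ⟨h, hl⟩
      · obtain rfl := le_antisymm (ht l) (h' t)
        exact Or.inr ⟨h, hl⟩
    have hdisj : Disjoint (fun r : C → C → Prop => IsUnimodalOrder r ∧ ∀ x, r b x)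
        (fun r => IsUnimodalOrder r ∧ ∀ x, r t x) := by
      rw [Pi.disjoint_iff]
      intro r
      rw [Prop.disjoint_iff]
      by_contra! h
      exact hbt (h.1.1.2.1 _ _ (h.1.2 t) (h.2.2 b))
    rw [Nat.card_congr ((Equiv.subtypeEquivRight hiff).trans (subtypeOrEquiv _ _ hdisj)),
      Nat.card_sum, hcard b (Or.inl hb), hcard t (Or.inr ht), pow_succ, mul_two]

/-- A finite chain with `n ≥ 2` elements carries exactly `2 ^ (n - 2)` compatible total
orders; equivalently, there are `2 ^ (n - 2)` commutative idempotent residuated chains of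
size `n` up to isomorphism. -/
theorem stmt_9 {C : Type*} [Fintype C] [LinearOrder C] (n : ℕ) (hn : 2 ≤ n)
    (hcard : Fintype.card C = n) :
    Nat.card {r : C → C → Prop // IsCompatTotalOrder r} = 2 ^ (n - 2) := by
  have : Nonempty C := Fintype.card_pos_iff.1 (by omega)
  obtain ⟨b, hb⟩ : ∃ b : C, IsBot b :=
    exists_greatest_of_trans_total (fun x y : C => y ≤ x) (fun _ _ _ h h' => h'.trans h)
      (fun x y => le_total y x)
  have hiff : ∀ r : C → C → Prop, IsCompatTotalOrder r ↔ IsUnimodalOrder r ∧ ∀ x, r b x := by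
    intro r
    rw [isCompatTotalOrder_iff]
    refine and_congr_right fun _ => ⟨fun h => h b hb, fun h c hc => ?_⟩
    obtain rfl := le_antisymm (hc b) (hb c)
    exact h
  rw [Nat.card_congr ((Equiv.subtypeEquivRight hiff).trans
    (unimodalOrderEquivOfLeast b (Or.inl hb)))]
  apply card_isUnimodalOrder
  rw [Nat.card_eq_fintype_card]
  simp only [ne_eq, Fintype.card_subtype_compl, Fintype.card_subtype_eq, hcard]
  omega
end

section
/- Let A be a commutative idempotent residuated chain, write ¬x := x→1, and let S = {x ∈ A : ¬¬x = x} (the skeleton of A). Then 1 ∈ S and S is closed under the operations ∧, ∨, ·, and → of A; that is, S is the universe of a subalgebra of A. -/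
/-- Left multiplication by any element is monotone when it has a residual. -/
theorem mul_le_mul_left_of_residuated {α : Type*} [Preorder α] [Mul α] {arrow : α → α → α}
    (resid : ∀ a b c : α, a * b ≤ c ↔ b ≤ arrow a c) (a : α) {b c : α} (h : b ≤ c) :
    a * b ≤ a * c :=
  (resid _ _ _).2 (h.trans ((resid _ _ _).1 le_rfl))

/-- In a commutative idempotent totally ordered monoid, multiplication is conservative. -/
theorem mul_eq_left_or_right_of_idem {α : Type*} [LinearOrder α] [CommMonoid α]
    (mono : ∀ a b c : α, b ≤ c → a * b ≤ a * c) (idem : ∀ a : α, a * a = a) (x y : α) :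
    x * y = x ∨ x * y = y := by
  wlog hxy : x ≤ y generalizing x y
  · rw [mul_comm, or_comm]
    exact this y x (le_of_not_ge hxy)
  have hx : x ≤ x * y := by simpa only [idem] using mono x x y hxy
  have hy : x * y ≤ y := by simpa only [idem, mul_comm y x] using mono y x y hxy
  rcases le_total (x * y) 1 with h | h
  · have hz := mono x _ _ h
    rw [← mul_assoc, idem, mul_one] at hz
    exact Or.inl (le_antisymm hz hx)
  · have hz := mono y _ _ h
    rw [mul_left_comm, idem, mul_one] at hz
    exact Or.inr (le_antisymm hy hz)

/-- For a commutative idempotent residuated chain, with `¬x := x → 1`, the skeleton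
`S = {x : ¬¬x = x}` contains `1` and is closed under `⊓`, `⊔`, `*` and `→`. -/
theorem stmt_10 {α : Type*} [LinearOrder α] [CommMonoid α]
    (arrow : α → α → α)
    (resid : ∀ a b c : α, a * b ≤ c ↔ b ≤ arrow a c)
    (idem : ∀ a : α, a * a = a) :
    arrow (arrow 1 1) 1 = (1 : α) ∧
    ∀ x y : α, arrow (arrow x 1) 1 = x → arrow (arrow y 1) 1 = y →
      (arrow (arrow (x ⊓ y) 1) 1 = x ⊓ y ∧
       arrow (arrow (x ⊔ y) 1) 1 = x ⊔ y ∧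
       arrow (arrow (x * y) 1) 1 = x * y ∧
       arrow (arrow (arrow x y) 1) 1 = arrow x y) := by
  have mono : ∀ a b c : α, b ≤ c → a * b ≤ a * c := fun a _ _ h =>
    mul_le_mul_left_of_residuated resid a h
  have one_arrow : ∀ c : α, arrow 1 c = c := fun c =>
    eq_of_forall_le_iff fun b => by rw [← resid, one_mul]
  have le_comm : ∀ a b : α, a ≤ arrow b 1 ↔ b ≤ arrow a 1 := fun a b => by
    rw [← resid, ← resid, mul_comm]
  have le_neg_neg : ∀ a : α, a ≤ arrow (arrow a 1) 1 := fun a => (le_comm _ _).1 le_rfl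
  have neg_neg_neg : ∀ a : α, arrow (arrow (arrow a 1) 1) 1 = arrow a 1 := fun a =>
    le_antisymm ((le_comm _ _).1 ((le_neg_neg _).trans (le_neg_neg _))) (le_neg_neg _)
  have curry : ∀ a b c : α, arrow a (arrow b c) = arrow (b * a) c := fun a b c =>
    eq_of_forall_le_iff fun d => by rw [← resid, ← resid, ← resid, mul_assoc]
  refine ⟨by rw [one_arrow, one_arrow], fun x y hx hy => ⟨?_, ?_, ?_, ?_⟩⟩
  · rcases min_choice x y with h | h <;> rw [h] <;> assumption
  · rcases max_choice x y with h | h <;> rw [h] <;> assumption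
  · rcases mul_eq_left_or_right_of_idem mono idem x y with h | h <;> rw [h] <;> assumption
  · rw [← hy, curry, neg_neg_neg]
end

section
/- Let A be an idempotent residuated chain. Then: (i) if x, y ∈ A and x·y ≠ y·x, then x and y have different signs, and in fact either x < 1 < y or y < 1 < x; (ii) each element has at most one element it fails to commute with: if x·y ≠ y·x and x·z ≠ z·x, then y = z. -/
section OrderedBand

variable {α : Type*} [LinearOrder α] [Monoid α]

/-- Residuation makes multiplication monotone in both arguments. -/
theorem mul_le_mul_of_residuated (ldiv rdiv : α → α → α)
    (hld : ∀ a b c : α, b ≤ ldiv a c ↔ a * b ≤ c)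
    (hrd : ∀ a b c : α, a * b ≤ c ↔ a ≤ rdiv c b)
    {a b c d : α} (hab : a ≤ b) (hcd : c ≤ d) : a * c ≤ b * d :=
  ((hrd a c (b * c)).2 (hab.trans ((hrd b c (b * c)).1 le_rfl))).trans
    ((hld b c (b * d)).1 (hcd.trans ((hld b d (b * d)).2 le_rfl)))

theorem mul_eq_min_of_le_one
    (mono : ∀ {a b c d : α}, a ≤ b → c ≤ d → a * c ≤ b * d)
    (idem : ∀ a : α, a * a = a)
    {x y : α} (hx : x ≤ 1) (hy : y ≤ 1) : x * y = min x y := by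
  apply le_antisymm
  · exact le_min (by simpa using mono (le_refl x) hy) (by simpa using mono hx (le_refl y))
  · simpa [idem] using mono (min_le_left x y) (min_le_right x y)

theorem mul_eq_max_of_one_le
    (mono : ∀ {a b c d : α}, a ≤ b → c ≤ d → a * c ≤ b * d)
    (idem : ∀ a : α, a * a = a)
    {x y : α} (hx : 1 ≤ x) (hy : 1 ≤ y) : x * y = max x y := by
  apply le_antisymm
  · simpa [idem] using mono (le_max_left x y) (le_max_right x y)
  · exact max_le (by simpa using mono (le_refl x) hy) (by simpa using mono hx (le_refl y))

theorem lt_one_lt_of_mul_ne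
    (mono : ∀ {a b c d : α}, a ≤ b → c ≤ d → a * c ≤ b * d)
    (idem : ∀ a : α, a * a = a)
    {x y : α} (h : x * y ≠ y * x) :
    (x < 1 ∧ 1 < y) ∨ (y < 1 ∧ 1 < x) := by
  rcases lt_trichotomy x 1 with hx | rfl | hx
  · refine Or.inl ⟨hx, lt_of_not_ge fun hy => h ?_⟩
    rw [mul_eq_min_of_le_one mono idem hx.le hy, mul_eq_min_of_le_one mono idem hy hx.le,
      min_comm]
  · simp at h
  · refine Or.inr ⟨lt_of_not_ge fun hy => h ?_, hx⟩
    rw [mul_eq_max_of_one_le mono idem hx.le hy, mul_eq_max_of_one_le mono idem hy hx.le,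
      max_comm]

/-- A totally ordered idempotent monoid is conservative. -/
theorem mul_eq_left_or_right
    (mono : ∀ {a b c d : α}, a ≤ b → c ≤ d → a * c ≤ b * d)
    (idem : ∀ a : α, a * a = a)
    (x y : α) : x * y = x ∨ x * y = y := by
  have hl : x * (x * y) = x * y := by rw [← mul_assoc, idem]
  have hr : x * y * y = x * y := by rw [mul_assoc, idem]
  rcases le_total x 1 with hx | hx <;> rcases le_total y 1 with hy | hy
  · rw [mul_eq_min_of_le_one mono idem hx hy]; exact min_choice x y
  · rcases le_total (x * y) 1 with h | h
    · rw [mul_eq_min_of_le_one mono idem hx h,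
        min_eq_left (by simpa using mono (le_refl x) hy)] at hl
      exact Or.inl hl.symm
    · rw [mul_eq_max_of_one_le mono idem h hy,
        max_eq_right (by simpa using mono hx (le_refl y))] at hr
      exact Or.inr hr.symm
  · rcases le_total (x * y) 1 with h | h
    · rw [mul_eq_min_of_le_one mono idem h hy,
        min_eq_right (by simpa using mono hx (le_refl y))] at hr
      exact Or.inr hr.symm
    · rw [mul_eq_max_of_one_le mono idem hx h,
        max_eq_left (by simpa using mono (le_refl x) hy)] at hl
      exact Or.inl hl.symm
  · rw [mul_eq_max_of_one_le mono idem hx hy]; exact max_choice x y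

/-- If `x` is a left zero for `y` and a right zero for `z`, then `x` is not strictly on one side
of both. -/
theorem not_lt_and_lt_of_mul_eq
    (mono : ∀ {a b c d : α}, a ≤ b → c ≤ d → a * c ≤ b * d)
    {x y z : α} (hxy : x * y = x) (hyx : y * x = y)
    (hxz : x * z = z) (hzx : z * x = x) : ¬ ((x < y ∧ x < z) ∨ (y < x ∧ z < x)) := by
  rcases le_total y z with h | h
  · have h₁ := mono h (le_refl x)
    have h₂ := mono (le_refl x) h
    rw [hyx, hzx] at h₁
    rw [hxy, hxz] at h₂
    rintro (⟨h₃, -⟩ | ⟨-, h₃⟩)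
    exacts [h₁.not_gt h₃, h₂.not_gt h₃]
  · have h₁ := mono h (le_refl x)
    have h₂ := mono (le_refl x) h
    rw [hyx, hzx] at h₁
    rw [hxy, hxz] at h₂
    rintro (⟨-, h₃⟩ | ⟨h₃, -⟩)
    exacts [h₂.not_gt h₃, h₁.not_gt h₃]

theorem eq_of_mul_ne_of_mul_ne
    (mono : ∀ {a b c d : α}, a ≤ b → c ≤ d → a * c ≤ b * d)
    (idem : ∀ a : α, a * a = a)
    {x y z : α} (hy : x * y ≠ y * x) (hz : x * z ≠ z * x) :
    y = z := by
  have side : (x < y ∧ x < z) ∨ (y < x ∧ z < x) := by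
    rcases lt_one_lt_of_mul_ne mono idem hy with ⟨h₁, h₂⟩ | ⟨h₁, h₂⟩ <;>
    rcases lt_one_lt_of_mul_ne mono idem hz with ⟨h₃, h₄⟩ | ⟨h₃, h₄⟩
    · exact Or.inl ⟨h₁.trans h₂, h₃.trans h₄⟩
    · exact absurd h₁ h₄.not_gt
    · exact absurd h₃ h₂.not_gt
    · exact Or.inr ⟨h₁.trans h₂, h₃.trans h₄⟩
  have comm : y * z = z * y := by
    by_contra h
    rcases lt_one_lt_of_mul_ne mono idem hy with ⟨h₁, h₂⟩ | ⟨h₁, h₂⟩ <;>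
    rcases lt_one_lt_of_mul_ne mono idem hz with ⟨h₃, h₄⟩ | ⟨h₃, h₄⟩ <;>
    rcases lt_one_lt_of_mul_ne mono idem h with ⟨h₅, h₆⟩ | ⟨h₅, h₆⟩ <;> order
  have zeros (w : α) (hw : x * w ≠ w * x) :
      (x * w = x ∧ w * x = w) ∨ (x * w = w ∧ w * x = x) := by
    have h₁ := mul_eq_left_or_right mono idem x w
    have h₂ := mul_eq_left_or_right mono idem w x
    grind
  rcases zeros y hy with ⟨hxy, hyx⟩ | ⟨hxy, hyx⟩ <;>
  rcases zeros z hz with ⟨hxz, hzx⟩ | ⟨hxz, hzx⟩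
  · calc y = y * x * z := by rw [mul_assoc, hxz, hyx]
      _ = z * x * y := by rw [hyx, hzx, comm]
      _ = z := by rw [mul_assoc, hxy, hzx]
  · exact absurd side (not_lt_and_lt_of_mul_eq mono hxy hyx hxz hzx)
  · exact absurd (side.imp And.symm And.symm) (not_lt_and_lt_of_mul_eq mono hxz hzx hxy hyx)
  · calc y = z * x * y := by rw [hzx, hxy]
      _ = y * x * z := by rw [mul_assoc, mul_assoc, hxy, hxz, comm]
      _ = z := by rw [hyx, hxz]

end OrderedBand

/-- In an idempotent residuated chain: (i) noncommuting elements have different signs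
(one is strictly below `1`, the other strictly above); (ii) each element fails to commute
with at most one element. -/
theorem stmt_13 {α : Type*} [LinearOrder α] [Monoid α]
    (ldiv rdiv : α → α → α)
    (hld : ∀ a b c : α, b ≤ ldiv a c ↔ a * b ≤ c)
    (hrd : ∀ a b c : α, a * b ≤ c ↔ a ≤ rdiv c b)
    (idem : ∀ a : α, a * a = a) :
    (∀ x y : α, x * y ≠ y * x → (x < 1 ∧ 1 < y) ∨ (y < 1 ∧ 1 < x)) ∧
    (∀ x y z : α, x * y ≠ y * x → x * z ≠ z * x → y = z) := by
  have mono {a b c d : α} (hab : a ≤ b) (hcd : c ≤ d) : a * c ≤ b * d :=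
    mul_le_mul_of_residuated ldiv rdiv hld hrd hab hcd
  exact ⟨fun _ _ => lt_one_lt_of_mul_ne mono idem, fun _ _ _ => eq_of_mul_ne_of_mul_ne mono idem⟩
end

section
/- On ℤ with its usual total order, define x·y = x if |y| ≤ |x| and x·y = y otherwise. Then (ℤ, min, max, ·, 0) is an idempotent totally ordered monoid (· is associative and idempotent with identity 0), · is residuated (for all x, y ∈ ℤ, the sets {z ∈ ℤ : x·z ≤ y} and {z ∈ ℤ : z·x ≤ y} have greatest elements, denoted x\y and y/x respectively), and the resulting idempotent residuated chain is generated by {−1}: the only subset of ℤ containing −1 and closed under min, max, ·, \, and / is ℤ itself. (Hence the variety of semilinear idempotent residuated lattices is not locally finite.) -/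
/-- On `ℤ` with its usual order, the operation `x · y = x` if `|y| ≤ |x|` and `y`
otherwise makes `ℤ` an idempotent residuated chain with identity `0`, and this algebra is
generated by `{-1}`: any subset containing `-1` and closed under `min`, `max`, `·`, `\`
and `/` is all of `ℤ`. Hence the variety of semilinear idempotent residuated lattices is
not locally finite. -/
theorem stmt_16 (m : ℤ → ℤ → ℤ)
    (hm : ∀ x y : ℤ, (|y| ≤ |x| → m x y = x) ∧ (|x| < |y| → m x y = y)) :
    (∀ x y z : ℤ, m (m x y) z = m x (m y z)) ∧
    (∀ x : ℤ, m x x = x) ∧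
    (∀ x : ℤ, m x 0 = x ∧ m 0 x = x) ∧
    ∃ ld rd : ℤ → ℤ → ℤ,
      (∀ x y : ℤ, m x (ld x y) ≤ y ∧ ∀ z : ℤ, m x z ≤ y → z ≤ ld x y) ∧
      (∀ x y : ℤ, m (rd y x) x ≤ y ∧ ∀ z : ℤ, m z x ≤ y → z ≤ rd y x) ∧
      ∀ S : Set ℤ, (-1 : ℤ) ∈ S →
        (∀ a ∈ S, ∀ b ∈ S,
          min a b ∈ S ∧ max a b ∈ S ∧ m a b ∈ S ∧ ld a b ∈ S ∧ rd a b ∈ S) →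
        S = Set.univ := by
  have hm' : ∀ x y : ℤ, m x y = if |y| ≤ |x| then x else y := by
    intro x y
    split_ifs with h
    · exact (hm x y).1 h
    · exact (hm x y).2 (not_le.mp h)
  refine ⟨?_, ?_, ?_,
    fun x y => if x ≤ y then max |x| y else min y (-|x| - 1),
    fun y x => if x ≤ y then max y (|x| - 1) else min y (-|x|), ?_, ?_, ?_⟩
  · intro x y z
    simp only [hm']
    grind
  · intro x
    simp [hm']
  · intro x
    simp +contextual [hm', eq_comm]
  · intro x y
    simp only [hm']
    grind
  · intro x y
    simp only [hm']
    grind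
  · intro S h1 hS
    have hsucc : ∀ n : ℕ, (n + 1 : ℤ) ∈ S ∧ -(n + 1 : ℤ) ∈ S := by
      have hpos : ∀ n : ℕ, -(n + 1 : ℤ) ∈ S → (n + 1 : ℤ) ∈ S := by
        intro n hn
        have h := (hS _ hn _ hn).2.2.2.1
        convert h using 1
        clear h hS hm hm'
        grind
      intro n
      induction n with
      | zero => exact ⟨hpos 0 (by simpa using h1), by simpa using h1⟩
      | succ k ih =>
        have hneg : -(((k + 1 : ℕ) : ℤ) + 1) ∈ S := by
          have h := (hS _ ih.1 _ ih.2).2.2.2.1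
          convert h using 1
          clear h hS hm hm'
          grind
        exact ⟨hpos _ hneg, hneg⟩
    have h0 : (0 : ℤ) ∈ S := by simpa using (hS _ h1 _ h1).2.2.2.2
    refine Set.eq_univ_of_forall fun x => ?_
    rcases lt_trichotomy x 0 with hx | rfl | hx
    · convert (hsucc (-x - 1).toNat).2 using 1
      omega
    · exact h0
    · convert (hsucc (x - 1).toNat).1 using 1
      omega
end

section
/- Let A be a conservative residuated lattice and B ⊆ A a finite subset with 1 ∈ B. Then there exists a finite subset C ⊆ A with B ⊆ C such that: C is closed under ∨ and ·; C has a ≤-least element ⊥ satisfying ⊥·a = ⊥ = a·⊥ for all a ∈ C; for all a, b ∈ C, the sets {c ∈ C : a·c ≤ b} and {c ∈ C : c·a ≤ b} have greatest elements; and for all a, b ∈ C, if a\b ∈ B then max{c ∈ C : a·c ≤ b} = a\b, and if b/a ∈ B then max{c ∈ C : c·a ≤ b} = b/a. (This yields the finite embeddability property for varieties generated by positive-universal classes of conservative residuated lattices.) -/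
/-- A nonempty finite subset of a join-semilattice, cut out by a join-closed predicate from a
join-closed finset, has a greatest element. -/
theorem Finset.exists_greatest_of_supClosed {α : Type*} [SemilatticeSup α] (C : Finset α)
    (p : α → Prop) (hC : ∀ a ∈ C, ∀ b ∈ C, a ⊔ b ∈ C)
    (hp : ∀ a b, p a → p b → p (a ⊔ b)) (hne : ∃ c ∈ C, p c) :
    ∃ z ∈ C, p z ∧ ∀ w ∈ C, p w → w ≤ z := by
  classical
  obtain ⟨c, hc, hpc⟩ := hne
  obtain ⟨z, hz⟩ := (C.filter p).exists_maximal ⟨c, by simp [hc, hpc]⟩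
  obtain ⟨hzC, hpz⟩ := Finset.mem_filter.1 hz.prop
  refine ⟨z, hzC, hpz, fun w hw hpw => le_sup_right.trans (hz.le_of_ge ?_ le_sup_left)⟩
  exact Finset.mem_filter.2 ⟨hC z hzC w hw, hp z w hpz hpw⟩

/-- In a conservative residuated lattice, every finite set containing `1` has a lower bound
that is absorbed by multiplication with each element of the set. -/
theorem exists_annihilating_lowerBound {α : Type*} [Lattice α] [Monoid α]
    (ldiv rdiv : α → α → α)
    (hld : ∀ a b c : α, b ≤ ldiv a c ↔ a * b ≤ c)
    (hrd : ∀ a b c : α, a * b ≤ c ↔ a ≤ rdiv c b)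
    (cons : ∀ a b : α, a * b = a ∨ a * b = b)
    (B : Finset α) (hB : (1 : α) ∈ B) :
    ∃ bot : α, ∀ a ∈ B, bot ≤ a ∧ a * bot = bot ∧ bot * a = bot := by
  have hne : B.Nonempty := ⟨1, hB⟩
  set m := B.inf' hne id
  have hm : ∀ a ∈ B, m ≤ a := fun a ha => Finset.inf'_le id ha
  set bot := m ⊓ B.inf' hne (fun a => ldiv a m ⊓ rdiv m a)
  have hbm : bot ≤ m := inf_le_left
  have hbr : ∀ a ∈ B, bot ≤ ldiv a m ⊓ rdiv m a := fun a ha =>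
    inf_le_right.trans (Finset.inf'_le (fun a => ldiv a m ⊓ rdiv m a) ha)
  refine ⟨bot, fun a ha => ⟨hbm.trans (hm a ha), ?_, ?_⟩⟩
  · refine (cons a bot).elim (fun h => ?_) id
    have ham : a ≤ m := h ▸ (hld _ _ _).1 ((hbr a ha).trans inf_le_left)
    have hab : a * bot ≤ bot :=
      (hrd _ _ _).2 ((ham.trans (hm 1 hB)).trans ((hrd _ _ _).1 (one_mul bot).le))
    exact le_antisymm hab ((hbm.trans (hm a ha)).trans h.ge)
  · refine (cons bot a).elim id (fun h => ?_)
    have ham : a ≤ m := h ▸ (hrd _ _ _).2 ((hbr a ha).trans inf_le_right)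
    have hab : bot * a ≤ bot :=
      (hld _ _ _).1 ((ham.trans (hm 1 hB)).trans ((hld _ _ _).2 (mul_one bot).le))
    exact le_antisymm hab ((hbm.trans (hm a ha)).trans h.ge)

/-- Finite embeddability construction for conservative residuated lattices: any finite
subset `B` containing `1` of a conservative residuated lattice extends to a finite subset
`Cs` closed under `⊔` and `*`, with a least element that is an annihilator, in which all
residuals exist, and whose residuals agree with those of `A` whenever the latter lie in
`B`. -/
theorem stmt_17 {α : Type*} [Lattice α] [Monoid α]
    (ldiv rdiv : α → α → α)
    (hld : ∀ a b c : α, b ≤ ldiv a c ↔ a * b ≤ c)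
    (hrd : ∀ a b c : α, a * b ≤ c ↔ a ≤ rdiv c b)
    (cons : ∀ a b : α, a * b = a ∨ a * b = b)
    (B : Finset α) (hB : (1 : α) ∈ B) :
    ∃ Cs : Finset α, B ⊆ Cs ∧
      (∀ a ∈ Cs, ∀ b ∈ Cs, a ⊔ b ∈ Cs ∧ a * b ∈ Cs) ∧
      (∃ bot ∈ Cs, (∀ a ∈ Cs, bot ≤ a) ∧ ∀ a ∈ Cs, a * bot = bot ∧ bot * a = bot) ∧
      (∀ a ∈ Cs, ∀ b ∈ Cs,
        (∃ z ∈ Cs, a * z ≤ b ∧ ∀ w ∈ Cs, a * w ≤ b → w ≤ z) ∧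
        (∃ z ∈ Cs, z * a ≤ b ∧ ∀ w ∈ Cs, w * a ≤ b → w ≤ z)) ∧
      (∀ a ∈ Cs, ∀ b ∈ Cs,
        (ldiv a b ∈ B →
          ldiv a b ∈ Cs ∧ a * ldiv a b ≤ b ∧ ∀ w ∈ Cs, a * w ≤ b → w ≤ ldiv a b) ∧
        (rdiv b a ∈ B →
          rdiv b a ∈ Cs ∧ rdiv b a * a ≤ b ∧ ∀ w ∈ Cs, w * a ≤ b → w ≤ rdiv b a)) := by
  obtain ⟨bot, hbot⟩ := exists_annihilating_lowerBound ldiv rdiv hld hrd cons B hB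
  have sup_mul_le : ∀ a b c d : α, a * c ≤ d → b * c ≤ d → (a ⊔ b) * c ≤ d :=
    fun a b c d h₁ h₂ => (hrd _ _ _).2 (sup_le ((hrd _ _ _).1 h₁) ((hrd _ _ _).1 h₂))
  have mul_sup_le : ∀ a b c d : α, c * a ≤ d → c * b ≤ d → c * (a ⊔ b) ≤ d :=
    fun a b c d h₁ h₂ => (hld _ _ _).1 (sup_le ((hld _ _ _).2 h₁) ((hld _ _ _).2 h₂))
  have bot_idem : bot * bot = bot := (cons bot bot).elim id id
  have hfin : (supClosure (insert bot (B : Set α))).Finite :=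
    ((B.finite_toSet).insert bot).supClosure
  have hbelow : supClosure (insert bot (B : Set α)) ⊆
      {a | bot ≤ a ∧ a * bot ≤ bot ∧ bot * a ≤ bot} := by
    refine supClosure_min ?_ ?_
    · rintro a (rfl | ha)
      · exact ⟨le_rfl, bot_idem.le, bot_idem.le⟩
      · exact ⟨(hbot a ha).1, (hbot a ha).2.1.le, (hbot a ha).2.2.le⟩
    · rintro a ⟨ha, ha₁, ha₂⟩ b ⟨_, hb₁, hb₂⟩
      exact ⟨le_sup_of_le_left ha, sup_mul_le _ _ _ _ ha₁ hb₁, mul_sup_le _ _ _ _ ha₂ hb₂⟩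
  obtain ⟨C, hC⟩ : ∃ C : Finset α, ∀ a, a ∈ C ↔ a ∈ supClosure (insert bot (B : Set α)) :=
    ⟨hfin.toFinset, fun a => hfin.mem_toFinset⟩
  have hBC : B ⊆ C := fun a ha => (hC a).2 (subset_supClosure (Or.inr ha))
  have hbotC : bot ∈ C := (hC bot).2 (subset_supClosure (Or.inl rfl))
  have hCsup : ∀ a ∈ C, ∀ b ∈ C, a ⊔ b ∈ C := fun a ha b hb =>
    (hC _).2 (supClosed_supClosure ((hC a).1 ha) ((hC b).1 hb))
  have hCbot : ∀ a ∈ C, bot ≤ a ∧ a * bot ≤ bot ∧ bot * a ≤ bot :=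
    fun a ha => hbelow ((hC a).1 ha)
  refine ⟨C, hBC, fun a ha b hb => ⟨hCsup a ha b hb, ?_⟩, ⟨bot, hbotC, fun a ha => (hCbot a ha).1,
    fun a ha => ?_⟩, fun a ha b hb => ⟨?_, ?_⟩, fun a _ b _ => ⟨fun h => ?_, fun h => ?_⟩⟩
  · rcases cons a b with h | h <;> rw [h] <;> assumption
  · obtain ⟨hle, h₁, h₂⟩ := hCbot a ha
    exact ⟨(cons a bot).elim (fun h => le_antisymm h₁ (hle.trans h.ge)) id,
      (cons bot a).elim id (fun h => le_antisymm h₂ (hle.trans h.ge))⟩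
  · exact C.exists_greatest_of_supClosed (fun z => a * z ≤ b) hCsup
      (fun c d => mul_sup_le c d a b) ⟨bot, hbotC, (hCbot a ha).2.1.trans (hCbot b hb).1⟩
  · exact C.exists_greatest_of_supClosed (fun z => z * a ≤ b) hCsup
      (fun c d => sup_mul_le c d a b) ⟨bot, hbotC, (hCbot a ha).2.2.trans (hCbot b hb).1⟩
  · exact ⟨hBC h, (hld _ _ _).1 le_rfl, fun w _ hw => (hld _ _ _).2 hw⟩
  · exact ⟨hBC h, (hrd _ _ _).2 le_rfl, fun w _ hw => (hrd _ _ _).1 hw⟩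
end

section
/- The class of totally ordered odd Sugihara monoids has the amalgamation property: given totally ordered odd Sugihara monoids A, B, C and embeddings i₁ : A → B and i₂ : A → C, there exist a totally ordered odd Sugihara monoid D and embeddings j₁ : B → D and j₂ : C → D such that j₁ ∘ i₁ = j₂ ∘ i₂. -/
universe u

/-- A totally ordered odd Sugihara monoid, bundled: a commutative idempotent residuated
chain satisfying `(x → 1) → 1 = x`. -/
structure OddSugiharaChain : Type (u + 1) where
  carrier : Type u
  [ord : LinearOrder carrier]
  mul : carrier → carrier → carrier
  one : carrier
  arrow : carrier → carrier → carrier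
  mul_assoc : ∀ a b c, mul (mul a b) c = mul a (mul b c)
  mul_comm : ∀ a b, mul a b = mul b a
  one_mul : ∀ a, mul one a = a
  mul_one : ∀ a, mul a one = a
  mul_idem : ∀ a, mul a a = a
  resid : ∀ a b c, mul a b ≤ c ↔ b ≤ arrow a c
  odd : ∀ a, arrow (arrow a one) one = a

attribute [instance] OddSugiharaChain.ord

/-- An embedding of totally ordered odd Sugihara monoids: an injective map preserving
`⊓ (= min)`, `⊔ (= max)`, `·`, `→` and `1`. -/
def IsOSMEmbedding (X Y : OddSugiharaChain) (f : X.carrier → Y.carrier) : Prop :=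
  Function.Injective f ∧
  (∀ a b, f (min a b) = min (f a) (f b)) ∧
  (∀ a b, f (max a b) = max (f a) (f b)) ∧
  (∀ a b, f (X.mul a b) = Y.mul (f a) (f b)) ∧
  (∀ a b, f (X.arrow a b) = Y.arrow (f a) (f b)) ∧
  f X.one = Y.one

/-- Amalgamation of linear orders: order embeddings `i : α → β`, `j : α → γ` of chains can be
completed to a commutative square of chains. -/
theorem exists_linearOrder_amalgam {α β γ : Type u} [LinearOrder α] [LinearOrder β]
    [LinearOrder γ] {i : α → β} {j : α → γ} (hi : StrictMono i) (hj : StrictMono j) :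
    ∃ (Q : Type u) (_ : LinearOrder Q) (f : β → Q) (g : γ → Q),
      StrictMono f ∧ StrictMono g ∧ ∀ a, f (i a) = g (j a) := by
  let r : β ⊕ γ → β ⊕ γ → Prop
    | .inl b, .inl b' => b ≤ b'
    | .inr c, .inr c' => c ≤ c'
    | .inl b, .inr c => ∃ a, b ≤ i a ∧ j a ≤ c
    | .inr c, .inl b => ∃ a, c ≤ j a ∧ i a ≤ b
  let P : Preorder (β ⊕ γ) :=
    { le := r
      lt := fun x y => r x y ∧ ¬ r y x
      le_refl := by rintro (b | c) <;> exact le_rfl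
      le_trans := by
        rintro (x | x) (y | y) (z | z) hxy hyz
        · exact le_trans (α := β) hxy hyz
        · obtain ⟨a, h, h'⟩ := hyz
          exact ⟨a, le_trans (α := β) hxy h, h'⟩
        · obtain ⟨a, h, h'⟩ := hxy
          obtain ⟨a', k, k'⟩ := hyz
          exact h.trans ((hi.monotone (hj.le_iff_le.1 (h'.trans k))).trans k')
        · obtain ⟨a, h, h'⟩ := hxy
          exact ⟨a, h, le_trans (α := γ) h' hyz⟩
        · obtain ⟨a, h, h'⟩ := hxy
          exact ⟨a, h, le_trans (α := β) h' hyz⟩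
        · obtain ⟨a, h, h'⟩ := hxy
          obtain ⟨a', k, k'⟩ := hyz
          exact h.trans ((hj.monotone (hi.le_iff_le.1 (h'.trans k))).trans k')
        · obtain ⟨a, h, h'⟩ := hyz
          exact ⟨a, le_trans (α := γ) hxy h, h'⟩
        · exact le_trans (α := γ) hxy hyz }
  let φ : β ⊕ γ → LinearExtension (Antisymmetrization (β ⊕ γ) P.le) :=
    fun x => toLinearExtension (toAntisymmetrization P.le x)
  have hφ : ∀ x y, r x y → φ x ≤ φ y := fun x y h => toLinearExtension.monotone h
  have hφ' : ∀ x y, φ x = φ y → r x y := fun x y h => (Quotient.exact h : AntisymmRel _ x y).1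
  refine ⟨_, inferInstance, φ ∘ .inl, φ ∘ .inr, ?_, ?_, ?_⟩
  · exact fun b b' h => lt_of_le_of_ne (hφ _ _ h.le) fun e =>
      h.not_ge (hφ' (.inl b') (.inl b) e.symm)
  · exact fun c c' h => lt_of_le_of_ne (hφ _ _ h.le) fun e =>
      h.not_ge (hφ' (.inr c') (.inr c) e.symm)
  · exact fun a => le_antisymm (hφ _ _ ⟨a, le_rfl, le_rfl⟩) (hφ _ _ ⟨a, le_rfl, le_rfl⟩)

namespace OddSugiharaChain

/-- The involution `x ↦ x → 1`. -/
def neg (X : OddSugiharaChain.{u}) (a : X.carrier) : X.carrier := X.arrow a X.one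

section
variable (X : OddSugiharaChain.{u})

theorem neg_neg (a : X.carrier) : X.neg (X.neg a) = a := X.odd a

theorem le_neg_iff {a b : X.carrier} : b ≤ X.neg a ↔ X.mul a b ≤ X.one := (X.resid a b X.one).symm

theorem le_neg_comm {a b : X.carrier} : b ≤ X.neg a ↔ a ≤ X.neg b := by
  rw [le_neg_iff, le_neg_iff, X.mul_comm]

theorem neg_le_neg_iff {a b : X.carrier} : X.neg a ≤ X.neg b ↔ b ≤ a := by
  rw [le_neg_comm, neg_neg]

theorem neg_one : X.neg X.one = X.one :=
  le_antisymm (by simpa [X.one_mul] using X.le_neg_iff.1 (le_refl (X.neg X.one)))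
    (X.le_neg_iff.2 (X.one_mul _).le)

theorem eq_one_of_neg_eq {a : X.carrier} (h : X.neg a = a) : a = X.one := by
  have h1 : a ≤ X.one := by
    simpa [X.mul_idem] using X.le_neg_iff.1 h.ge
  refine le_antisymm h1 ?_
  simpa [X.neg_one, h] using X.neg_le_neg_iff.2 h1

theorem mul_le_mul_left {b c : X.carrier} (a : X.carrier) (h : b ≤ c) : X.mul a b ≤ X.mul a c :=
  (X.resid _ _ _).2 (h.trans ((X.resid _ _ _).1 le_rfl))

theorem mul_le_max (a b : X.carrier) : X.mul a b ≤ max a b := by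
  rcases le_total a b with h | h
  · rw [X.mul_comm, max_eq_right h]
    simpa [X.mul_idem] using X.mul_le_mul_left b h
  · rw [max_eq_left h]
    simpa [X.mul_idem] using X.mul_le_mul_left a h

theorem min_le_mul (a b : X.carrier) : min a b ≤ X.mul a b := by
  rcases le_total a b with h | h
  · rw [min_eq_left h]
    simpa [X.mul_idem] using X.mul_le_mul_left a h
  · rw [X.mul_comm, min_eq_right h]
    simpa [X.mul_idem] using X.mul_le_mul_left b h

theorem mul_eq (a b : X.carrier) :
    X.mul a b = if a ≤ X.neg b then min a b else max a b := by
  have key : ∀ a b : X.carrier, X.mul a (X.mul a b) = X.mul a b := fun a b => by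
    rw [← X.mul_assoc, X.mul_idem]
  split_ifs with h
  · have h1 : X.mul a b ≤ X.one := X.le_neg_iff.1 (X.le_neg_comm.1 h)
    refine le_antisymm (le_min ?_ ?_) (X.min_le_mul a b)
    · simpa [key, X.mul_one] using X.mul_le_mul_left a h1
    · rw [X.mul_comm] at h1 ⊢
      simpa [key, X.mul_one] using X.mul_le_mul_left b h1
  · have h1 : X.one ≤ X.mul a b :=
      (not_le.1 fun h' => h (X.le_neg_comm.1 (X.le_neg_iff.2 h'))).le
    refine le_antisymm (X.mul_le_max a b) (max_le ?_ ?_)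
    · simpa [key, X.mul_one] using X.mul_le_mul_left a h1
    · rw [X.mul_comm] at h1 ⊢
      simpa [key, X.mul_one] using X.mul_le_mul_left b h1

theorem arrow_eq (a c : X.carrier) : X.arrow a c = X.neg (X.mul a (X.neg c)) := by
  refine eq_of_forall_le_iff fun x => ?_
  rw [← X.resid, X.le_neg_iff, X.mul_comm a (X.neg c), X.mul_assoc, ← X.le_neg_iff, neg_neg]

end

/-- A strictly monotone map commuting with the involutions is an embedding. -/
theorem isOSMEmbedding_of_strictMono {X Y : OddSugiharaChain.{u}} {f : X.carrier → Y.carrier}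
    (hf : StrictMono f) (hneg : ∀ a, f (X.neg a) = Y.neg (f a)) : IsOSMEmbedding X Y f := by
  have hmul : ∀ a b, f (X.mul a b) = Y.mul (f a) (f b) := fun a b => by
    simp only [mul_eq, ← hneg, hf.le_iff_le, ← hf.monotone.map_min, ← hf.monotone.map_max,
      apply_ite f]
  refine ⟨hf.injective, fun _ _ => hf.monotone.map_min, fun _ _ => hf.monotone.map_max, hmul,
    fun a b => ?_, Y.eq_one_of_neg_eq ?_⟩
  · rw [arrow_eq, arrow_eq, hneg, hmul, hneg]
  · rw [← hneg, neg_one]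

theorem _root_.IsOSMEmbedding.strictMono {X Y : OddSugiharaChain.{u}} {f : X.carrier → Y.carrier}
    (hf : IsOSMEmbedding X Y f) : StrictMono f :=
  Monotone.strictMono_of_injective
    (fun a b h => by simpa [min_eq_left h] using hf.2.1 a b) hf.1

theorem _root_.IsOSMEmbedding.map_neg {X Y : OddSugiharaChain.{u}} {f : X.carrier → Y.carrier}
    (hf : IsOSMEmbedding X Y f) (a : X.carrier) : f (X.neg a) = Y.neg (f a) := by
  rw [neg, neg, hf.2.2.2.2.1, hf.2.2.2.2.2]

/-- The odd Sugihara chain determined by a chain with an antitone involution `n` with fixed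
point `e` (which is then the only one). -/
def ofInvolution (α : Type u) [LinearOrder α] (n : α → α) (e : α) (hn : ∀ a, n (n a) = a)
    (hle : ∀ a b, a ≤ n b → b ≤ n a) (he : n e = e) :
    OddSugiharaChain.{u} where
  carrier := α
  mul a b := if a ≤ n b then min a b else max a b
  one := e
  arrow a c := n (if a ≤ n (n c) then min a (n c) else max a (n c))
  mul_assoc a b c := by
    have := hle a b; have := hle b a; have := hle a c; have := hle c a
    have := hle b c; have := hle c b
    grind
  mul_comm a b := by
    have := hle a b; have := hle b a
    grind
  one_mul a := by
    have := hle a a; have := hle (n a) e; have := hle e (n a); have := hle a e; have := hle e a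
    grind
  mul_one a := by
    have := hle a a; have := hle (n a) e; have := hle e (n a); have := hle a e; have := hle e a
    grind
  mul_idem a := by simp
  resid a b c := by
    have := hle a b; have := hle b a; have := hle a (n c); have := hle (n c) a
    have := hle b (n c); have := hle (n c) b
    grind
  odd a := by
    have h : ∀ a, (if a ≤ n (n e) then min a (n e) else max a (n e)) = a := by grind
    rw [h, h, hn]

theorem neg_ofInvolution {α : Type u} [LinearOrder α] {n : α → α} {e : α} (hn : ∀ a, n (n a) = a)
    (hle : ∀ a b, a ≤ n b → b ≤ n a) (he : n e = e) (a : α) :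
    (ofInvolution α n e hn hle he).neg a = n a := by
  change n (if a ≤ n (n e) then min a (n e) else max a (n e)) = n a
  grind

/-- Pairs consisting of a positive part and a negative part over the base point `e`, at least one
of which is trivial. The product order of `Q × Qᵒᵈ` is total on these pairs. -/
abbrev SignedPair (Q : Type u) [LinearOrder Q] (e : Q) : Type u :=
  {p : Q × Qᵒᵈ // e ≤ p.1 ∧ e ≤ OrderDual.ofDual p.2 ∧ (p.1 = e ∨ OrderDual.ofDual p.2 = e)}

theorem SignedPair.le_iff {Q : Type u} [LinearOrder Q] {e : Q} {p q : SignedPair Q e} :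
    p ≤ q ↔ p.1.1 ≤ q.1.1 ∧ OrderDual.ofDual q.1.2 ≤ OrderDual.ofDual p.1.2 := Iff.rfl

noncomputable instance (Q : Type u) [LinearOrder Q] (e : Q) : LinearOrder (SignedPair Q e) where
  le_total p q := by
    obtain ⟨p, hp⟩ := p
    obtain ⟨q, hq⟩ := q
    simp only [SignedPair.le_iff]
    grind
  toDecidableLE := Classical.decRel _

/-- The odd Sugihara chain whose elements above `1` form the chain `{x : Q // e ≤ x}`. -/
noncomputable def signed (Q : Type u) [LinearOrder Q] (e : Q) : OddSugiharaChain.{u} :=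
  ofInvolution (SignedPair Q e)
    (fun p => ⟨(OrderDual.ofDual p.1.2, OrderDual.toDual p.1.1), p.2.2.1, p.2.1, p.2.2.2.symm⟩)
    ⟨(e, OrderDual.toDual e), le_rfl, le_rfl, .inl rfl⟩
    (fun _ => rfl) (fun _ _ h => And.intro h.2 h.1) rfl

/-- The map sending an element to its positive and negative parts. -/
noncomputable def toSigned (X : OddSugiharaChain.{u}) {Q : Type u} [LinearOrder Q] {e : Q}
    {f : X.carrier → Q} (hf : StrictMono f) (he : f X.one = e) (a : X.carrier) :
    (signed Q e).carrier :=
  (⟨(f (max a X.one), OrderDual.toDual (f (max (X.neg a) X.one))),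
    he.ge.trans (hf.monotone (le_max_right _ _)), he.ge.trans (hf.monotone (le_max_right _ _)), by
      rw [← he]
      rcases le_total a X.one with h | h
      · exact .inl (congrArg f (max_eq_right h))
      · refine .inr (congrArg f (max_eq_right ?_))
        simpa [X.neg_one] using X.neg_le_neg_iff.2 h⟩ : SignedPair Q e)

theorem isOSMEmbedding_toSigned (X : OddSugiharaChain.{u}) {Q : Type u} [LinearOrder Q]
    {e : Q} {f : X.carrier → Q} (hf : StrictMono f) (he : f X.one = e) :
    IsOSMEmbedding X (signed Q e) (X.toSigned hf he) := by
  refine isOSMEmbedding_of_strictMono (Monotone.strictMono_of_injective ?_ ?_) fun a => ?_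
  · intro a b h
    exact ⟨hf.monotone (max_le_max_right _ h),
      hf.monotone (max_le_max_right _ (X.neg_le_neg_iff.2 h))⟩
  · intro a b h
    have h1 : max a X.one = max b X.one :=
      hf.injective (congrArg (fun p : SignedPair Q e => p.1.1) h)
    have h2 : max (X.neg a) X.one = max (X.neg b) X.one :=
      hf.injective (congrArg (fun p : SignedPair Q e => OrderDual.ofDual p.1.2) h)
    have := X.neg_neg a
    have := X.neg_neg b
    have := X.neg_one
    have := X.neg_le_neg_iff (a := a) (b := X.one)
    have := X.neg_le_neg_iff (a := b) (b := X.one)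
    grind
  · refine Eq.trans ?_ (neg_ofInvolution _ _ _ _).symm
    apply Subtype.ext
    apply Prod.ext
    · rfl
    · exact congrArg (fun x => f (max x X.one)) (X.neg_neg a)

end OddSugiharaChain

/-- The class of totally ordered odd Sugihara monoids has the amalgamation property. -/
theorem stmt_18 (A B C : OddSugiharaChain.{u})
    (i₁ : A.carrier → B.carrier) (i₂ : A.carrier → C.carrier)
    (h₁ : IsOSMEmbedding A B i₁) (h₂ : IsOSMEmbedding A C i₂) :
    ∃ (D : OddSugiharaChain.{u}) (j₁ : B.carrier → D.carrier)
      (j₂ : C.carrier → D.carrier),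
      IsOSMEmbedding B D j₁ ∧ IsOSMEmbedding C D j₂ ∧
      ∀ a, j₁ (i₁ a) = j₂ (i₂ a) := by
  obtain ⟨Q, _, f, g, hf, hg, hfg⟩ := exists_linearOrder_amalgam h₁.strictMono h₂.strictMono
  have hone : g C.one = f B.one := by
    rw [← h₁.2.2.2.2.2, hfg, h₂.2.2.2.2.2]
  refine ⟨_, _, _, B.isOSMEmbedding_toSigned hf rfl, C.isOSMEmbedding_toSigned hg hone,
    fun a => Subtype.ext (Prod.ext ?_ ?_)⟩
  · change f (max (i₁ a) B.one) = g (max (i₂ a) C.one)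
    rw [← h₁.2.2.2.2.2, ← h₂.2.2.2.2.2, ← h₁.2.2.1, ← h₂.2.2.1, hfg]
  · change f (max (B.neg (i₁ a)) B.one) = g (max (C.neg (i₂ a)) C.one)
    rw [← h₁.map_neg, ← h₂.map_neg, ← h₁.2.2.2.2.2, ← h₂.2.2.2.2.2, ← h₁.2.2.1, ← h₂.2.2.1, hfg]
end

section
/- The class of commutative idempotent residuated chains has the amalgamation property: given commutative idempotent residuated chains A, B, C and embeddings i₁ : A → B and i₂ : A → C, there exist a commutative idempotent residuated chain D and embeddings j₁ : B → D and j₂ : C → D such that j₁ ∘ i₁ = j₂ ∘ i₂. -/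
universe u

/-- A commutative idempotent residuated chain, bundled. -/
structure CommIdemResChain : Type (u + 1) where
  carrier : Type u
  [ord : LinearOrder carrier]
  mul : carrier → carrier → carrier
  one : carrier
  arrow : carrier → carrier → carrier
  mul_assoc : ∀ a b c, mul (mul a b) c = mul a (mul b c)
  mul_comm : ∀ a b, mul a b = mul b a
  one_mul : ∀ a, mul one a = a
  mul_one : ∀ a, mul a one = a
  mul_idem : ∀ a, mul a a = a
  resid : ∀ a b c, mul a b ≤ c ↔ b ≤ arrow a c

attribute [instance] CommIdemResChain.ord

/-- An embedding of commutative idempotent residuated chains: an injective map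
preserving `⊓ (= min)`, `⊔ (= max)`, `·`, `→` and `1`. -/
def IsCIRCEmbedding (X Y : CommIdemResChain) (f : X.carrier → Y.carrier) : Prop :=
  Function.Injective f ∧
  (∀ a b, f (min a b) = min (f a) (f b)) ∧
  (∀ a b, f (max a b) = max (f a) (f b)) ∧
  (∀ a b, f (X.mul a b) = Y.mul (f a) (f b)) ∧
  (∀ a b, f (X.arrow a b) = Y.arrow (f a) (f b)) ∧
  f X.one = Y.one

namespace CommIdemResChain

section Star

variable {X : Type*} [LinearOrder X] (star : X → X)

/-- The multiplication determined by the operation `a ↦ a → 1`. -/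
def starMul (a b : X) : X := if b ≤ star a then min a b else max a b

/-- The residual determined by the operation `a ↦ a → 1`. -/
def starArrow (a c : X) : X := if a ≤ c then max (star a) c else min (star a) c

theorem starMul_le_iff (a b c : X) : starMul star a b ≤ c ↔ b ≤ starArrow star a c := by
  unfold starMul starArrow
  grind

variable {star}

theorem starMul_comm (galois : ∀ a b, b ≤ star a ↔ a ≤ star b) (a b : X) :
    starMul star a b = starMul star b a := by
  unfold starMul
  simp only [galois a b, min_comm, max_comm]

theorem starMul_assoc {e : X} (star_e : star e = e)
    (galois : ∀ a b, b ≤ star a ↔ a ≤ star b) (a b c : X) :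
    starMul star (starMul star a b) c = starMul star a (starMul star b c) := by
  have sign (x : X) : e ≤ star x ↔ x ≤ e := by rw [galois, star_e]
  have := sign a
  have := sign b
  have := sign c
  have := galois a b
  have := galois a c
  have := galois b c
  unfold starMul
  grind

end Star

/-- A chain with a point `e` and a self-adjoint antitone Galois connection fixing `e` is the
same thing as a commutative idempotent residuated chain. -/
def ofStar (X : Type u) [LinearOrder X] (e : X) (star : X → X) (star_e : star e = e)
    (galois : ∀ a b, b ≤ star a ↔ a ≤ star b) : CommIdemResChain.{u} where
  carrier := X
  mul := starMul star
  one := e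
  arrow := starArrow star
  mul_assoc := starMul_assoc star_e galois
  mul_comm := starMul_comm galois
  one_mul a := by unfold starMul; grind
  mul_one a := by rw [starMul_comm galois]; unfold starMul; grind
  mul_idem a := by simp [starMul]
  resid := starMul_le_iff star

variable (X : CommIdemResChain.{u})

/-- The operation `a ↦ a → 1`. -/
def star (a : X.carrier) : X.carrier := X.arrow a X.one

theorem le_star_iff (a b : X.carrier) : b ≤ X.star a ↔ X.mul a b ≤ X.one :=
  (X.resid a b X.one).symm

theorem le_star_comm (a b : X.carrier) : b ≤ X.star a ↔ a ≤ X.star b := by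
  rw [le_star_iff, le_star_iff, X.mul_comm]

theorem star_one : X.star X.one = X.one :=
  eq_of_forall_le_iff fun b => by rw [le_star_iff, X.one_mul]

theorem one_le_star_iff (a : X.carrier) : X.one ≤ X.star a ↔ a ≤ X.one := by
  rw [le_star_comm, star_one]

theorem le_star_star (a : X.carrier) : a ≤ X.star (X.star a) := by
  rw [le_star_comm]

theorem star_anti {a b : X.carrier} (h : a ≤ b) : X.star b ≤ X.star a := by
  rw [le_star_comm]
  exact h.trans (X.le_star_star b)

theorem star_star_star (a : X.carrier) : X.star (X.star (X.star a)) = X.star a :=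
  le_antisymm (X.star_anti (X.le_star_star a)) (X.le_star_star _)

theorem mul_le_mul_left {b c : X.carrier} (a : X.carrier) (h : b ≤ c) :
    X.mul a b ≤ X.mul a c := by
  rw [X.resid]
  exact h.trans ((X.resid _ _ _).1 le_rfl)

theorem mul_le_mul_right {b c : X.carrier} (a : X.carrier) (h : b ≤ c) :
    X.mul b a ≤ X.mul c a := by
  rw [X.mul_comm b, X.mul_comm c]
  exact X.mul_le_mul_left a h

theorem min_le_mul (a b : X.carrier) : min a b ≤ X.mul a b := by
  rw [← X.mul_idem (min a b)]
  exact (X.mul_le_mul_left _ (min_le_right a b)).trans (X.mul_le_mul_right _ (min_le_left a b))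

theorem mul_le_max (a b : X.carrier) : X.mul a b ≤ max a b := by
  rw [← X.mul_idem (max a b)]
  exact (X.mul_le_mul_left _ (le_max_right a b)).trans (X.mul_le_mul_right _ (le_max_left a b))

theorem mul_eq_starMul (a b : X.carrier) : X.mul a b = starMul X.star a b := by
  have left : X.mul (X.mul a b) a = X.mul a b := by
    rw [X.mul_comm, ← X.mul_assoc, X.mul_idem]
  have right : X.mul (X.mul a b) b = X.mul a b := by
    rw [X.mul_assoc, X.mul_idem]
  unfold starMul
  split_ifs with h
  · rw [le_star_iff] at h
    have ha := X.mul_le_mul_right a h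
    have hb := X.mul_le_mul_right b h
    rw [X.one_mul, left] at ha
    rw [X.one_mul, right] at hb
    exact le_antisymm (le_min ha hb) (X.min_le_mul a b)
  · rw [le_star_iff, not_le] at h
    have ha := X.mul_le_mul_right a h.le
    have hb := X.mul_le_mul_right b h.le
    rw [X.one_mul, left] at ha
    rw [X.one_mul, right] at hb
    exact le_antisymm (X.mul_le_max a b) (max_le ha hb)

theorem arrow_eq_starArrow (a c : X.carrier) : X.arrow a c = starArrow X.star a c :=
  eq_of_forall_le_iff fun b => by rw [← X.resid, mul_eq_starMul, starMul_le_iff]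

variable {X}

/-- Strictly monotone maps preserving `1` and `a ↦ a → 1` are embeddings. -/
theorem isCIRCEmbedding_ofStar {Y : Type u} [LinearOrder Y] {e : Y} {st : Y → Y}
    (st_e : st e = e) (galois : ∀ a b, b ≤ st a ↔ a ≤ st b) {f : X.carrier → Y}
    (mono : StrictMono f) (map_one : f X.one = e) (map_star : ∀ a, f (X.star a) = st (f a)) :
    IsCIRCEmbedding X (ofStar Y e st st_e galois) f := by
  refine ⟨mono.injective, fun a b => mono.monotone.map_min, fun a b => mono.monotone.map_max,
    fun a b => ?_, fun a b => ?_, map_one⟩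
  · change _ = starMul st (f a) (f b)
    rw [mul_eq_starMul]
    simp only [starMul, ← map_star, mono.le_iff_le, ← mono.monotone.map_min,
      ← mono.monotone.map_max, apply_ite f]
  · change _ = starArrow st (f a) (f b)
    rw [arrow_eq_starArrow]
    simp only [starArrow, ← map_star, mono.le_iff_le, ← mono.monotone.map_min,
      ← mono.monotone.map_max, apply_ite f]

end CommIdemResChain

/-- Linear orders have the amalgamation property. -/
theorem exists_linearOrder_amalgam_s19 {A B C : Type u} [LinearOrder A] [LinearOrder B]
    [LinearOrder C] {f : A → B} {g : A → C} (hf : StrictMono f) (hg : StrictMono g) :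
    ∃ (M : Type u) (_ : LinearOrder M) (p : B → M) (q : C → M),
      StrictMono p ∧ StrictMono q ∧ ∀ a, p (f a) = q (g a) := by
  classical
  have key {E : Type u} [LinearOrder E] {h : A → E} (hh : StrictMono h)
      {k : E → B ⊕ₗ C} (hk : StrictMono k) :
      ∃ r : E → LowerSet A ×ₗ WithBot (B ⊕ₗ C), StrictMono r ∧
        ∀ a, r (h a) = toLex (LowerSet.Iic a, ⊥) := by
    refine ⟨fun x => toLex (⟨{a | h a ≤ x}, fun _ _ hab ha => (hh.monotone hab).trans ha⟩,
      if x ∈ Set.range h then ⊥ else (k x : WithBot (B ⊕ₗ C))), fun x y hxy => ?_, fun a => ?_⟩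
    · rw [Prod.Lex.toLex_lt_toLex']
      refine ⟨fun a ha => le_trans ha hxy.le, fun heq => ?_⟩
      have hy : y ∉ Set.range h := by
        rintro ⟨a, rfl⟩
        have : a ∈ {a' | h a' ≤ x} := by
          have := congrArg (fun s : LowerSet A => a ∈ s) heq
          exact this.mpr le_rfl
        exact absurd this (not_le.2 hxy)
      simp only [hy, if_false]
      split_ifs
      · exact WithBot.bot_lt_coe _
      · exact WithBot.coe_lt_coe.2 (hk hxy)
    · simp only [Set.mem_range_self, if_true]
      congr 2
      ext a'
      simp [hh.le_iff_le]
  obtain ⟨p, hp, hpf⟩ := key hf (k := fun b => toLex (Sum.inl b)) Sum.Lex.inl_strictMono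
  obtain ⟨q, hq, hqg⟩ := key hg (k := fun c => toLex (Sum.inr c)) Sum.Lex.inr_strictMono
  exact ⟨_, inferInstance, p, q, hp, hq, fun a => by rw [hpf, hqg]⟩

/-- The carrier of a commutative idempotent residuated chain into which every commutative
idempotent residuated chain whose order embeds into `M` can be embedded. The left summand
holds the elements `≤ 1`; its blocks are the classes of `a ↦ a → 1`, indexed by `a → 1`. The
right summand holds the elements `> 1`, with blocks indexed by `(a → 1) → 1`. -/
abbrev UniversalCarrier (M : Type u) : Type u :=
  ((WithBot M)ᵒᵈ ×ₗ WithTop M) ⊕ₗ (M ×ₗ WithTop M)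

namespace UniversalCarrier

variable {M : Type u}

/-- The element of index `t` in the block `i` of elements `≤ 1`. -/
def neg (i : WithBot M) (t : WithTop M) : UniversalCarrier M :=
  toLex (Sum.inl (toLex (OrderDual.toDual i, t)))

/-- The element of index `t` in the block `i` of elements `> 1`. -/
def pos (i : M) (t : WithTop M) : UniversalCarrier M :=
  toLex (Sum.inr (toLex (i, t)))

/-- The unit of the universal chain. -/
def one : UniversalCarrier M := neg ⊥ ⊤

/-- The operation `a ↦ a → 1` of the universal chain. -/
def star (x : UniversalCarrier M) : UniversalCarrier M :=
  match ofLex x with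
  | Sum.inl a => WithBot.recBotCoe one (fun i => pos i ⊤) (OrderDual.ofDual (ofLex a).1)
  | Sum.inr b => neg (ofLex b).1 ⊤

@[simp] theorem star_neg_bot (t : WithTop M) : star (neg ⊥ t) = one := rfl

@[simp] theorem star_neg_coe (i : M) (t : WithTop M) : star (neg i t) = pos i ⊤ := rfl

@[simp] theorem star_pos (i : M) (t : WithTop M) : star (pos i t) = neg i ⊤ := rfl

theorem star_one : star (one : UniversalCarrier M) = one := rfl

variable [LinearOrder M]

theorem neg_lt_neg {i j : WithBot M} {s t : WithTop M} :
    neg i s < neg j t ↔ j < i ∨ i = j ∧ s < t := by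
  simp [neg, Prod.Lex.toLex_lt_toLex]

theorem neg_le_neg {i j : WithBot M} {s t : WithTop M} :
    neg i s ≤ neg j t ↔ j < i ∨ i = j ∧ s ≤ t := by
  simp [neg, Prod.Lex.toLex_le_toLex]

theorem pos_lt_pos {i j : M} {s t : WithTop M} :
    pos i s < pos j t ↔ i < j ∨ i = j ∧ s < t := by
  simp [pos, Prod.Lex.toLex_lt_toLex]

theorem pos_le_pos {i j : M} {s t : WithTop M} :
    pos i s ≤ pos j t ↔ i < j ∨ i = j ∧ s ≤ t := by
  simp [pos, Prod.Lex.toLex_le_toLex]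

theorem neg_lt_pos (i : WithBot M) (j : M) (s t : WithTop M) : neg i s < pos j t := by
  simp [neg, pos]

theorem neg_le_pos (i : WithBot M) (j : M) (s t : WithTop M) : neg i s ≤ pos j t := by
  simp [neg, pos]

theorem not_pos_le_neg (i : WithBot M) (j : M) (s t : WithTop M) : ¬ pos j t ≤ neg i s := by
  simp [neg, pos]

theorem le_star_comm (x y : UniversalCarrier M) : y ≤ star x ↔ x ≤ star y := by
  have cases (z : UniversalCarrier M) :
      (∃ t, z = neg ⊥ t) ∨ (∃ (i : M) (t : _), z = neg i t) ∨ ∃ i t, z = pos i t := by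
    rcases z with ⟨i, t⟩ | ⟨i, t⟩
    · induction i using WithBot.recBotCoe with
      | bot => exact Or.inl ⟨t, rfl⟩
      | coe i => exact Or.inr (Or.inl ⟨i, t, rfl⟩)
    · exact Or.inr (Or.inr ⟨i, t, rfl⟩)
  rcases cases x with ⟨s, rfl⟩ | ⟨i, s, rfl⟩ | ⟨i, s, rfl⟩ <;>
    rcases cases y with ⟨t, rfl⟩ | ⟨j, t, rfl⟩ | ⟨j, t, rfl⟩ <;>
    simp [one, neg_le_neg, pos_le_pos, neg_le_pos, not_pos_le_neg, eq_comm]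

end UniversalCarrier

/-- The commutative idempotent residuated chain on `UniversalCarrier M`. -/
def universalChain (M : Type u) [LinearOrder M] : CommIdemResChain.{u} :=
  .ofStar (UniversalCarrier M) .one .star UniversalCarrier.star_one
    UniversalCarrier.le_star_comm

namespace CommIdemResChain

variable {X : CommIdemResChain.{u}} {M : Type u}

open UniversalCarrier in
/-- The embedding into the universal chain induced by a map to `M`. -/
noncomputable def toUniversal (f : X.carrier → M) (x : X.carrier) : UniversalCarrier M :=
  let t : WithTop M := if X.star (X.star x) = x then ⊤ else f x
  if x ≤ X.one then neg (if X.star x = X.one then ⊥ else f (X.star x)) t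
  else pos (f (X.star (X.star x))) t

theorem isCIRCEmbedding_toUniversal [LinearOrder M] {f : X.carrier → M} (hf : StrictMono f) :
    IsCIRCEmbedding X (universalChain M) (toUniversal f) := by
  refine isCIRCEmbedding_ofStar _ _ (fun x y hxy => ?_) ?_ fun x => ?_
  · have top (h : X.star (X.star x) = X.star (X.star y)) :
        (if X.star (X.star x) = x then (⊤ : WithTop M) else f x) <
          if X.star (X.star y) = y then (⊤ : WithTop M) else f y := by
      have hx : X.star (X.star x) ≠ x := fun hx =>
        absurd (X.le_star_star y) (by rw [← h, hx]; exact not_le.2 hxy)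
      rw [if_neg hx]
      split_ifs
      · exact WithTop.coe_lt_top _
      · exact WithTop.coe_lt_coe.2 (hf hxy)
    unfold toUniversal
    have hstar := X.star_anti hxy.le
    by_cases hx : x ≤ X.one <;> by_cases hy : y ≤ X.one
    · simp only [hx, hy, if_true, UniversalCarrier.neg_lt_neg]
      rcases hstar.eq_or_lt with heq | hlt
      · exact Or.inr ⟨by rw [heq], top (by rw [heq])⟩
      · left
        have hne : X.star x ≠ X.one := (((X.one_le_star_iff y).2 hy).trans_lt hlt).ne'
        rw [if_neg hne]
        split_ifs
        · exact WithBot.bot_lt_coe _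
        · exact WithBot.coe_lt_coe.2 (hf hlt)
    · simp only [hx, hy, if_true, if_false, UniversalCarrier.neg_lt_pos]
    · exact absurd (hxy.le.trans hy) hx
    · simp only [hx, hy, if_false, UniversalCarrier.pos_lt_pos]
      rcases (X.star_anti hstar).eq_or_lt with heq | hlt
      · exact Or.inr ⟨by rw [heq], top heq⟩
      · exact Or.inl (hf hlt)
  · simp [toUniversal, star_one, UniversalCarrier.one]
  · have hsign := X.one_le_star_iff x
    by_cases hx : x ≤ X.one
    · by_cases h1 : X.star x = X.one
      · simp [toUniversal, hx, h1, star_one]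
        rfl
      · have hlt : ¬ X.star x ≤ X.one := fun h => h1 (le_antisymm h (hsign.2 hx))
        simp [toUniversal, hx, h1, hlt, star_star_star]
    · have hlt : X.star x < X.one := not_le.1 (mt hsign.1 hx)
      have hne : X.star (X.star x) ≠ X.one := fun h =>
        hx (h ▸ X.le_star_star x)
      simp [toUniversal, hx, hlt.le, hne, star_star_star]

theorem toUniversal_comp {A : CommIdemResChain.{u}} {i : A.carrier → X.carrier}
    (hi : IsCIRCEmbedding A X i) (hmono : StrictMono i) (f : X.carrier → M) (a : A.carrier) :
    toUniversal f (i a) = toUniversal (fun a => f (i a)) a := by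
  obtain ⟨inj, -, -, -, map_arrow, map_one⟩ := hi
  have map_star (a : A.carrier) : X.star (i a) = i (A.star a) := by
    rw [star, star, map_arrow, map_one]
  simp only [toUniversal, map_star, ← map_one, inj.eq_iff, hmono.le_iff_le]

end CommIdemResChain

theorem IsCIRCEmbedding.strictMono {X Y : CommIdemResChain.{u}} {f : X.carrier → Y.carrier}
    (hf : IsCIRCEmbedding X Y f) : StrictMono f := by
  refine Monotone.strictMono_of_injective (fun a b hab => ?_) hf.1
  rw [← min_eq_left hab, hf.2.1]
  exact min_le_right _ _

/-- The class of commutative idempotent residuated chains has the amalgamation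
property. -/
theorem stmt_19 (A B C : CommIdemResChain.{u})
    (i₁ : A.carrier → B.carrier) (i₂ : A.carrier → C.carrier)
    (h₁ : IsCIRCEmbedding A B i₁) (h₂ : IsCIRCEmbedding A C i₂) :
    ∃ (D : CommIdemResChain.{u}) (j₁ : B.carrier → D.carrier)
      (j₂ : C.carrier → D.carrier),
      IsCIRCEmbedding B D j₁ ∧ IsCIRCEmbedding C D j₂ ∧
      ∀ a, j₁ (i₁ a) = j₂ (i₂ a) := by
  obtain ⟨M, _, p, q, hp, hq, hpq⟩ := exists_linearOrder_amalgam_s19 h₁.strictMono h₂.strictMono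
  refine ⟨universalChain M, CommIdemResChain.toUniversal p, CommIdemResChain.toUniversal q,
    CommIdemResChain.isCIRCEmbedding_toUniversal hp,
    CommIdemResChain.isCIRCEmbedding_toUniversal hq, fun a => ?_⟩
  rw [CommIdemResChain.toUniversal_comp h₁ h₁.strictMono,
    CommIdemResChain.toUniversal_comp h₂ h₂.strictMono, funext hpq]
end
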